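/- (Uniform CLT for landscapes.) Under the stated assumptions, there exist a constant C > 0 and N₀ such that for all n ≥ N₀, sup_{z ∈ ℝ} | Pⁿ( sup_{t ∈ [t₁,t₂]} |𝔾_n(t)| ≤ z ) − P( sup_{t ∈ [t₁,t₂]} |G(t)| ≤ z ) | ≤ C (log n)^{7/8} n^{−1/8}. -/

import Mathlib

open MeasureTheory ProbabilityTheory Set Filter

noncomputable section

/-- A landscape-type function for `T`: 1-Lipschitz, with values in `[0, T/2]`,
and vanishing outside `[0, T]`. -/
def IsLandscapeType (T : ℝ) (f : ℝ → ℝ) : Prop :=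
  LipschitzWith 1 f ∧ (∀ t, 0 ≤ f t ∧ f t ≤ T / 2) ∧ ∀ t ∉ Set.Icc (0 : ℝ) T, f t = 0

/-- The Borel σ-algebra on the space `C(ℝ, ℝ)` of continuous functions with the
topology of uniform convergence on compact sets (the compact-open topology). -/
instance : MeasurableSpace C(ℝ, ℝ) := borel _

instance : BorelSpace C(ℝ, ℝ) := ⟨rfl⟩

/-- The mean function `μ(t) = ∫ λ(t) dP(λ)`. -/
def lmean (P : Measure C(ℝ, ℝ)) (t : ℝ) : ℝ := ∫ f, f t ∂P

/-- The variance function `σ(t)² = ∫ λ(t)² dP(λ) − μ(t)²`. -/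
def lvar (P : Measure C(ℝ, ℝ)) (t : ℝ) : ℝ := (∫ f, (f t) ^ 2 ∂P) - (lmean P t) ^ 2

/-- The standard deviation function `σ(t)`. -/
def lsd (P : Measure C(ℝ, ℝ)) (t : ℝ) : ℝ := Real.sqrt (lvar P t)

/-- The empirical average `λ̄_n(t) = (1/n) Σ_i λ_i(t)` of a tuple of functions. -/
def empMean (n : ℕ) (l : Fin n → C(ℝ, ℝ)) (t : ℝ) : ℝ := (∑ i, l i t) / n

/-- The empirical standard deviation
`σ̂_n(t) = sqrt((1/n) Σ_i λ_i(t)² − λ̄_n(t)²)` of a tuple of functions. -/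
def empSD (n : ℕ) (l : Fin n → C(ℝ, ℝ)) (t : ℝ) : ℝ :=
  Real.sqrt ((∑ i, (l i t) ^ 2) / n - (empMean n l t) ^ 2)

/-- The covariance function `κ(t,s) = ∫ λ(t)λ(s) dP(λ) − μ(t)μ(s)`. -/
def lcov (P : Measure C(ℝ, ℝ)) (t s : ℝ) : ℝ :=
  (∫ f, f t * f s ∂P) - lmean P t * lmean P s

/-! ### Taylor expansion with crude remainder -/

lemma abs_sub_le_of_hasDerivAt_le {f f' : ℝ → ℝ} {M : ℝ} (hf : ∀ x, HasDerivAt f (f' x) x)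
    (hb : ∀ x ∈ Icc (0 : ℝ) 1, |f' x| ≤ M) {x : ℝ} (hx : x ∈ Icc (0 : ℝ) 1) :
    |f x - f 0| ≤ M := by
  have hM : 0 ≤ M := (abs_nonneg _).trans (hb 0 (by simp))
  have h := (convex_Icc (0 : ℝ) 1).norm_image_sub_le_of_norm_hasDerivWithin_le
    (fun y _ => (hf y).hasDerivWithinAt) (fun y hy => hb y hy) (by simp : (0 : ℝ) ∈ Icc (0 : ℝ) 1) hx
  have h2 : M * ‖x - 0‖ ≤ M * 1 := by
    gcongr
    rw [sub_zero, Real.norm_eq_abs, abs_of_nonneg hx.1]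
    exact hx.2
  simpa using h.trans h2

lemma abs_taylor_two_le {f f₁ f₂ f₃ : ℝ → ℝ} {M : ℝ} (h₀ : ∀ x, HasDerivAt f (f₁ x) x)
    (h₁ : ∀ x, HasDerivAt f₁ (f₂ x) x) (h₂ : ∀ x, HasDerivAt f₂ (f₃ x) x)
    (hb : ∀ x ∈ Icc (0 : ℝ) 1, |f₃ x| ≤ M) {x : ℝ} (hx : x ∈ Icc (0 : ℝ) 1) :
    |f x - (f 0 + f₁ 0 * x + f₂ 0 * x ^ 2 / 2)| ≤ M := by
  have a₂ : ∀ x ∈ Icc (0 : ℝ) 1, |f₂ x - f₂ 0| ≤ M := fun x hx =>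
    abs_sub_le_of_hasDerivAt_le h₂ hb hx
  have a₁ : ∀ x ∈ Icc (0 : ℝ) 1, |f₁ x - f₁ 0 - f₂ 0 * x| ≤ M := fun x hx => by
    have := abs_sub_le_of_hasDerivAt_le (f := fun x => f₁ x - f₂ 0 * x)
      (f' := fun x => f₂ x - f₂ 0)
      (fun x => ((h₁ x).sub ((hasDerivAt_id x).const_mul (f₂ 0))).congr_deriv (by simp)) a₂ hx
    convert this using 2
    ring
  have := abs_sub_le_of_hasDerivAt_le (f := fun x => f x - f₁ 0 * x - f₂ 0 * x ^ 2 / 2)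
      (f' := fun x => f₁ x - f₁ 0 - f₂ 0 * x)
      (fun x => by
        refine (((h₀ x).sub ((hasDerivAt_id x).const_mul (f₁ 0))).sub
          ((((hasDerivAt_id x).pow 2).const_mul (f₂ 0)).div_const 2)).congr_deriv ?_
        simp; ring) a₁ hx
  convert this using 2
  ring

lemma abs_taylor_three_le {f f₁ f₂ f₃ f₄ : ℝ → ℝ} {M : ℝ} (h₀ : ∀ x, HasDerivAt f (f₁ x) x)
    (h₁ : ∀ x, HasDerivAt f₁ (f₂ x) x) (h₂ : ∀ x, HasDerivAt f₂ (f₃ x) x)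
    (h₃ : ∀ x, HasDerivAt f₃ (f₄ x) x)
    (hb : ∀ x ∈ Icc (0 : ℝ) 1, |f₄ x| ≤ M) :
    |f 1 - (f 0 + f₁ 0 + f₂ 0 / 2 + f₃ 0 / 6)| ≤ M := by
  have a₁ : ∀ x ∈ Icc (0 : ℝ) 1, |f₁ x - (f₁ 0 + f₂ 0 * x + f₃ 0 * x ^ 2 / 2)| ≤ M :=
    fun x hx => abs_taylor_two_le h₁ h₂ h₃ hb hx
  have := abs_sub_le_of_hasDerivAt_le
      (f := fun x => f x - f₁ 0 * x - f₂ 0 * x ^ 2 / 2 - f₃ 0 * x ^ 3 / 6)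
      (f' := fun x => f₁ x - (f₁ 0 + f₂ 0 * x + f₃ 0 * x ^ 2 / 2))
      (fun x => by
        refine ((((h₀ x).sub ((hasDerivAt_id x).const_mul (f₁ 0))).sub
          ((((hasDerivAt_id x).pow 2).const_mul (f₂ 0)).div_const 2)).sub
          ((((hasDerivAt_id x).pow 3).const_mul (f₃ 0)).div_const 6)).congr_deriv ?_
        simp; ring) a₁ (x := 1) (by simp)
  convert this using 2
  ring

/-! ### The smooth maximum -/

section smoothMax

variable {ι : Type*} [Fintype ι]

/-- The smooth maximum `β⁻¹ log ∑ⱼ exp (β xⱼ)`. -/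
def smoothMax (β : ℝ) (x : ι → ℝ) : ℝ := β⁻¹ * Real.log (∑ j, Real.exp (β * x j))

lemma smoothMax_le_of_forall_le [Nonempty ι] {β : ℝ} (hβ : 0 < β) {x : ι → ℝ} {a : ℝ}
    (h : ∀ j, x j ≤ a) : smoothMax β x ≤ a + Real.log (Fintype.card ι) / β := by
  have h1 : ∑ j, Real.exp (β * x j) ≤ Fintype.card ι * Real.exp (β * a) := by
    calc ∑ j, Real.exp (β * x j) ≤ ∑ _j : ι, Real.exp (β * a) := by
          gcongr with j _; exact h j
      _ = _ := by simp
  have h0 : 0 < ∑ j, Real.exp (β * x j) := Finset.sum_pos (fun _ _ => Real.exp_pos _) (by simp)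
  have h2 := Real.log_le_log h0 h1
  rw [Real.log_mul (by simp) (Real.exp_pos _).ne', Real.log_exp] at h2
  unfold smoothMax
  calc _ ≤ β⁻¹ * (Real.log (Fintype.card ι) + β * a) := by gcongr
    _ = _ := by field_simp; ring

lemma le_smoothMax {β : ℝ} (hβ : 0 < β) (x : ι → ℝ) (j : ι) : x j ≤ smoothMax β x := by
  have h1 : Real.exp (β * x j) ≤ ∑ j, Real.exp (β * x j) :=
    Finset.single_le_sum (f := fun j => Real.exp (β * x j))
      (fun _ _ => (Real.exp_pos _).le) (Finset.mem_univ j)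
  have h2 := Real.log_le_log (Real.exp_pos _) h1
  rw [Real.log_exp] at h2
  unfold smoothMax
  calc x j = β⁻¹ * (β * x j) := by field_simp
    _ ≤ _ := by gcongr

lemma continuous_smoothMax [Nonempty ι] (β : ℝ) : Continuous (smoothMax β : (ι → ℝ) → ℝ) := by
  unfold smoothMax
  refine continuous_const.mul (Continuous.log (by fun_prop) fun x => ?_)
  exact (Finset.sum_pos (fun _ _ => Real.exp_pos _) (by simp)).ne'

/-- The moments `∑ⱼ yⱼᵏ exp (β xⱼ) / ∑ⱼ exp (β xⱼ)` of `y` under the softmax weights of `x`. -/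
def softMoment (β : ℝ) (x y : ι → ℝ) (k : ℕ) : ℝ :=
  (∑ j, y j ^ k * Real.exp (β * x j)) / ∑ j, Real.exp (β * x j)

lemma softMoment_neg (β : ℝ) (x y : ι → ℝ) (k : ℕ) :
    softMoment β x (-y) k = (-1) ^ k * softMoment β x y k := by
  simp only [softMoment, Pi.neg_apply, ← mul_div_assoc, Finset.mul_sum]
  congr 2 with j
  rw [neg_pow]; ring

lemma hasDerivAt_sum_pow_mul_exp (β : ℝ) (x y : ι → ℝ) (k : ℕ) (θ : ℝ) :
    HasDerivAt (fun θ => ∑ j, y j ^ k * Real.exp (β * (x + θ • y) j))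
      (β * ∑ j, y j ^ (k + 1) * Real.exp (β * (x + θ • y) j)) θ := by
  have : ∀ j ∈ Finset.univ, HasDerivAt (fun θ => y j ^ k * Real.exp (β * (x + θ • y) j))
      (β * (y j ^ (k + 1) * Real.exp (β * (x + θ • y) j))) θ := fun j _ => by
    have h : HasDerivAt (fun θ : ℝ => β * (x + θ • y) j) (β * y j) θ := by
      simpa using (((hasDerivAt_id θ).mul_const (y j)).const_add (x j)).const_mul β
    refine (h.exp.const_mul (y j ^ k)).congr_deriv ?_
    ring
  simpa [Finset.mul_sum] using HasDerivAt.fun_sum this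

variable [Nonempty ι]

lemma sum_exp_pos (β : ℝ) (x : ι → ℝ) : 0 < ∑ j, Real.exp (β * x j) :=
  Finset.sum_pos (fun _ _ => Real.exp_pos _) (by simp)

lemma abs_softMoment_le {β : ℝ} {x y : ι → ℝ} {b : ℝ} (hy : ∀ j, |y j| ≤ b) (k : ℕ) :
    |softMoment β x y k| ≤ b ^ k := by
  rw [softMoment, abs_div, abs_of_pos (sum_exp_pos β x), div_le_iff₀ (sum_exp_pos β x),
    Finset.mul_sum]
  refine (Finset.abs_sum_le_sum_abs _ _).trans (Finset.sum_le_sum fun j _ => ?_)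
  rw [abs_mul, abs_pow, abs_of_pos (Real.exp_pos _)]
  gcongr
  exact hy j

lemma hasDerivAt_softMoment (β : ℝ) (x y : ι → ℝ) (k : ℕ) (θ : ℝ) :
    HasDerivAt (fun θ => softMoment β (x + θ • y) y k)
      (β * (softMoment β (x + θ • y) y (k + 1)
        - softMoment β (x + θ • y) y k * softMoment β (x + θ • y) y 1)) θ := by
  have h0 := hasDerivAt_sum_pow_mul_exp β x y 0 θ
  simp only [pow_zero, one_mul] at h0
  have hne := (sum_exp_pos β (x + θ • y)).ne'
  refine ((hasDerivAt_sum_pow_mul_exp β x y k θ).div h0 hne).congr_deriv ?_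
  simp only [softMoment]
  field_simp
  simp

lemma hasDerivAt_smoothMax {β : ℝ} (hβ : 0 < β) (x y : ι → ℝ) (θ : ℝ) :
    HasDerivAt (fun θ => smoothMax β (x + θ • y)) (softMoment β (x + θ • y) y 1) θ := by
  have h0 := hasDerivAt_sum_pow_mul_exp β x y 0 θ
  simp only [pow_zero, one_mul] at h0
  have hne := (sum_exp_pos β (x + θ • y)).ne'
  refine ((h0.log hne).const_mul β⁻¹).congr_deriv ?_
  simp only [softMoment]
  field_simp
  simp

/-! ### Derivatives of smooth functions of the smooth maximum along lines -/

/-- First derivative of `g 0 ∘ smoothMax β` at `x` in direction `y`,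
where `g (k + 1)` is the derivative of `g k`. -/
def lineDerivOne (g : ℕ → ℝ → ℝ) (β : ℝ) (x y : ι → ℝ) : ℝ :=
  g 1 (smoothMax β x) * softMoment β x y 1

/-- Second derivative of `g 0 ∘ smoothMax β` at `x` in direction `y`. -/
def lineDerivTwo (g : ℕ → ℝ → ℝ) (β : ℝ) (x y : ι → ℝ) : ℝ :=
  g 2 (smoothMax β x) * softMoment β x y 1 ^ 2
    + g 1 (smoothMax β x) * (β * (softMoment β x y 2 - softMoment β x y 1 ^ 2))

/-- Third derivative of `g 0 ∘ smoothMax β` at `x` in direction `y`. -/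
def lineDerivThree (g : ℕ → ℝ → ℝ) (β : ℝ) (x y : ι → ℝ) : ℝ :=
  g 3 (smoothMax β x) * softMoment β x y 1 ^ 3
    + g 2 (smoothMax β x)
      * (3 * β * (softMoment β x y 1 * (softMoment β x y 2 - softMoment β x y 1 ^ 2)))
    + g 1 (smoothMax β x) * (β ^ 2 * (softMoment β x y 3
      - 3 * (softMoment β x y 1 * softMoment β x y 2) + 2 * softMoment β x y 1 ^ 3))

/-- Fourth derivative of `g 0 ∘ smoothMax β` at `x` in direction `y`. -/
def lineDerivFour (g : ℕ → ℝ → ℝ) (β : ℝ) (x y : ι → ℝ) : ℝ :=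
  g 4 (smoothMax β x) * softMoment β x y 1 ^ 4
    + g 3 (smoothMax β x) * (6 * β * (softMoment β x y 1 ^ 2
        * (softMoment β x y 2 - softMoment β x y 1 ^ 2)))
    + g 2 (smoothMax β x) * (β ^ 2 * (3 * softMoment β x y 2 ^ 2
        + 4 * (softMoment β x y 1 * softMoment β x y 3)
        - 18 * (softMoment β x y 1 ^ 2 * softMoment β x y 2) + 11 * softMoment β x y 1 ^ 4))
    + g 1 (smoothMax β x) * (β ^ 3 * (softMoment β x y 4
        - 4 * (softMoment β x y 1 * softMoment β x y 3) - 3 * softMoment β x y 2 ^ 2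
        + 12 * (softMoment β x y 1 ^ 2 * softMoment β x y 2) - 6 * softMoment β x y 1 ^ 4))

section
variable {g : ℕ → ℝ → ℝ} (hg : ∀ k u, HasDerivAt (g k) (g (k + 1) u) u) {β : ℝ} (hβ : 0 < β)
  (x y : ι → ℝ) (θ : ℝ)
include hg hβ

lemma hasDerivAt_comp_smoothMax (k : ℕ) : HasDerivAt (fun θ => g k (smoothMax β (x + θ • y)))
    (g (k + 1) (smoothMax β (x + θ • y)) * softMoment β (x + θ • y) y 1) θ :=
  (hg k _).comp θ (hasDerivAt_smoothMax hβ x y θ)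

lemma hasDerivAt_lineDerivOne : HasDerivAt (fun θ => lineDerivOne g β (x + θ • y) y)
    (lineDerivTwo g β (x + θ • y) y) θ := by
  refine ((hasDerivAt_comp_smoothMax hg hβ x y θ 1).mul
    (hasDerivAt_softMoment β x y 1 θ)).congr_deriv ?_
  simp only [lineDerivTwo]; ring

lemma hasDerivAt_lineDerivTwo : HasDerivAt (fun θ => lineDerivTwo g β (x + θ • y) y)
    (lineDerivThree g β (x + θ • y) y) θ := by
  have G := hasDerivAt_comp_smoothMax hg hβ x y θ
  have R := fun k => hasDerivAt_softMoment β x y k θ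
  refine (((G 2).mul ((R 1).pow 2)).add ((G 1).mul
    (((R 2).sub ((R 1).pow 2)).const_mul β))).congr_deriv ?_
  simp [lineDerivThree]; ring

lemma hasDerivAt_lineDerivThree : HasDerivAt (fun θ => lineDerivThree g β (x + θ • y) y)
    (lineDerivFour g β (x + θ • y) y) θ := by
  have G := hasDerivAt_comp_smoothMax hg hβ x y θ
  have R := fun k => hasDerivAt_softMoment β x y k θ
  refine ((((G 3).mul ((R 1).pow 3)).add ((G 2).mul
    (((R 1).mul ((R 2).sub ((R 1).pow 2))).const_mul (3 * β)))).add ((G 1).mul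
    ((((R 3).sub (((R 1).mul (R 2)).const_mul 3)).add
      (((R 1).pow 3).const_mul 2)).const_mul (β ^ 2)))).congr_deriv ?_
  simp [lineDerivFour]; ring

end

lemma abs_add_le_of_le {a b A B : ℝ} (ha : |a| ≤ A) (hb : |b| ≤ B) : |a + b| ≤ A + B :=
  (abs_add_le _ _).trans (add_le_add ha hb)

lemma abs_sub_le_of_le {a b A B : ℝ} (ha : |a| ≤ A) (hb : |b| ≤ B) : |a - b| ≤ A + B :=
  (abs_sub _ _).trans (add_le_add ha hb)

lemma abs_mul_le_of_le {a b A B : ℝ} (ha : |a| ≤ A) (hb : |b| ≤ B) : |a * b| ≤ A * B := by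
  rw [abs_mul]; exact mul_le_mul ha hb (abs_nonneg _) ((abs_nonneg _).trans ha)

lemma abs_pow_le_of_le {a A : ℝ} (ha : |a| ≤ A) (k : ℕ) : |a ^ k| ≤ A ^ k := by
  rw [abs_pow]; exact pow_le_pow_left₀ (abs_nonneg _) ha k

section
variable {g : ℕ → ℝ → ℝ} {A ψ β : ℝ} (hA : 0 ≤ A) (hψ : 0 < ψ) (hψβ : ψ ≤ β)
  (hgb : ∀ k ≤ 4, ∀ u, |g k u| ≤ A * ψ ^ k)
include hA hψ hψβ hgb

lemma abs_lineDerivThree_le {x y : ι → ℝ} {b : ℝ} (hb : 0 ≤ b) (hy : ∀ j, |y j| ≤ b) :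
    |lineDerivThree g β x y| ≤ 13 * A * (ψ * β ^ 2) * b ^ 3 := by
  have hβ : 0 < β := hψ.trans_le hψβ
  have R := fun k => abs_softMoment_le (β := β) (x := x) hy k
  have e : ∀ c : ℝ, 0 ≤ c → |c| ≤ c := fun c hc => (abs_of_nonneg hc).le
  refine (abs_add_le_of_le (abs_add_le_of_le
    (abs_mul_le_of_le (hgb 3 (by norm_num) _) (abs_pow_le_of_le (R 1) 3))
    (abs_mul_le_of_le (hgb 2 (by norm_num) _) (abs_mul_le_of_le (e (3 * β) (by positivity))
      (abs_mul_le_of_le (R 1) (abs_sub_le_of_le (R 2) (abs_pow_le_of_le (R 1) 2))))))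
    (abs_mul_le_of_le (hgb 1 (by norm_num) _) (abs_mul_le_of_le (e (β ^ 2) (by positivity))
      (abs_add_le_of_le (abs_sub_le_of_le (R 3) (abs_mul_le_of_le (e 3 (by norm_num))
        (abs_mul_le_of_le (R 1) (R 2))))
        (abs_mul_le_of_le (e 2 (by norm_num)) (abs_pow_le_of_le (R 1) 3)))))).trans ?_
  have h1 : ψ ^ 3 ≤ ψ * β ^ 2 := by
    have : ψ ^ 2 ≤ β ^ 2 := by gcongr
    nlinarith
  have h2 : ψ ^ 2 * β ≤ ψ * β ^ 2 := by nlinarith [mul_pos hψ hβ]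
  have hAb : 0 ≤ A * b ^ 3 := by positivity
  have := mul_le_mul_of_nonneg_left h1 hAb
  have := mul_le_mul_of_nonneg_left h2 hAb
  ring_nf at *
  linarith

lemma abs_lineDerivFour_le {x y : ι → ℝ} {b : ℝ} (hy : ∀ j, |y j| ≤ b) :
    |lineDerivFour g β x y| ≤ 75 * A * (ψ * β ^ 3) * b ^ 4 := by
  have hβ : 0 < β := hψ.trans_le hψβ
  have R := fun k => abs_softMoment_le (β := β) (x := x) hy k
  have e : ∀ c : ℝ, 0 ≤ c → |c| ≤ c := fun c hc => (abs_of_nonneg hc).le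
  have R12 := abs_mul_le_of_le (abs_pow_le_of_le (R 1) 2) (R 2)
  have R13 := abs_mul_le_of_le (R 1) (R 3)
  have R22 := abs_pow_le_of_le (R 2) 2
  have R14 := abs_pow_le_of_le (R 1) 4
  refine (abs_add_le_of_le (abs_add_le_of_le (abs_add_le_of_le
    (abs_mul_le_of_le (hgb 4 (by norm_num) _) R14)
    (abs_mul_le_of_le (hgb 3 (by norm_num) _) (abs_mul_le_of_le (e (6 * β) (by positivity))
      (abs_mul_le_of_le (abs_pow_le_of_le (R 1) 2)
        (abs_sub_le_of_le (R 2) (abs_pow_le_of_le (R 1) 2))))))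
    (abs_mul_le_of_le (hgb 2 (by norm_num) _) (abs_mul_le_of_le (e (β ^ 2) (by positivity))
      (abs_add_le_of_le (abs_sub_le_of_le (abs_add_le_of_le
        (abs_mul_le_of_le (e 3 (by norm_num)) R22) (abs_mul_le_of_le (e 4 (by norm_num)) R13))
        (abs_mul_le_of_le (e 18 (by norm_num)) R12))
        (abs_mul_le_of_le (e 11 (by norm_num)) R14)))))
    (abs_mul_le_of_le (hgb 1 (by norm_num) _) (abs_mul_le_of_le (e (β ^ 3) (by positivity))
      (abs_sub_le_of_le (abs_add_le_of_le (abs_sub_le_of_le (abs_sub_le_of_le (R 4)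
        (abs_mul_le_of_le (e 4 (by norm_num)) R13)) (abs_mul_le_of_le (e 3 (by norm_num)) R22))
        (abs_mul_le_of_le (e 12 (by norm_num)) R12))
        (abs_mul_le_of_le (e 6 (by norm_num)) R14))))).trans ?_
  have h1 : ψ ^ 4 ≤ ψ * β ^ 3 := by
    have : ψ ^ 3 ≤ β ^ 3 := by gcongr
    nlinarith
  have h2 : ψ ^ 3 * β ≤ ψ * β ^ 3 := by
    have : ψ ^ 2 ≤ β ^ 2 := by gcongr
    nlinarith [mul_pos hψ hβ]
  have h3 : ψ ^ 2 * β ^ 2 ≤ ψ * β ^ 3 := by nlinarith [mul_pos (mul_pos hψ hβ) hβ]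
  have hAb : 0 ≤ A * b ^ 4 := by positivity
  have := mul_le_mul_of_nonneg_left h1 hAb
  have := mul_le_mul_of_nonneg_left h2 hAb
  have := mul_le_mul_of_nonneg_left h3 hAb
  ring_nf at *
  linarith

end

end smoothMax

/-! ### A smooth step function -/

lemma exists_smooth_step : ∃ (h : ℕ → ℝ → ℝ) (A : ℝ), 0 ≤ A ∧
    (∀ k u, HasDerivAt (h k) (h (k + 1) u) u) ∧ (∀ k ≤ 4, ∀ u, |h k u| ≤ A) ∧
    (∀ u ≤ 0, h 0 u = 1) ∧ (∀ u, 1 ≤ u → h 0 u = 0) ∧ ∀ u, 0 ≤ h 0 u ∧ h 0 u ≤ 1 := by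
  set f : ℝ → ℝ := fun u => Real.smoothTransition (1 - u) with hf
  have hfc : ContDiff ℝ ((⊤ : ℕ∞) : WithTop ℕ∞) f :=
    Real.smoothTransition.contDiff.comp (contDiff_const.sub contDiff_id)
  have hd : ∀ k u, HasDerivAt (iteratedDeriv k f) (iteratedDeriv (k + 1) f u) u := fun k u => by
    rw [iteratedDeriv_succ]
    exact (hfc.differentiable_iteratedDeriv k (by exact_mod_cast ENat.natCast_lt_top k) u).hasDerivAt
  have hcs : ∀ k, HasCompactSupport (iteratedDeriv (k + 1) f) := by
    intro k
    induction k with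
    | zero =>
      refine HasCompactSupport.intro (isCompact_Icc (a := (0 : ℝ)) (b := 1)) fun x hx => ?_
      rw [zero_add, iteratedDeriv_one]
      rcases lt_or_ge x 0 with h0 | h0
      · have : f =ᶠ[nhds x] fun _ => 1 := by
          filter_upwards [Iio_mem_nhds h0] with y hy
          exact Real.smoothTransition.one_of_one_le (by linarith [mem_Iio.1 hy])
        rw [this.deriv_eq, deriv_const]
      · have h1 : 1 < x := by
          by_contra hc
          exact hx ⟨h0, not_lt.1 hc⟩
        have : f =ᶠ[nhds x] fun _ => 0 := by
          filter_upwards [Ioi_mem_nhds h1] with y hy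
          exact Real.smoothTransition.zero_of_nonpos (by linarith [mem_Ioi.1 hy])
        rw [this.deriv_eq, deriv_const]
    | succ k ih =>
      rw [iteratedDeriv_succ]
      exact ih.deriv
  have hbd : ∀ k, ∃ A, ∀ u, |iteratedDeriv k f u| ≤ A := by
    intro k
    rcases k with _ | k
    · refine ⟨1, fun u => ?_⟩
      rw [iteratedDeriv_zero, abs_of_nonneg (Real.smoothTransition.nonneg _)]
      exact Real.smoothTransition.le_one _
    · have hc : Continuous (iteratedDeriv (k + 1) f) :=
        continuous_iff_continuousAt.2 fun u => (hd _ u).continuousAt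
      exact hc.bounded_above_of_compact_support (hcs k)
  choose A hA using hbd
  refine ⟨fun k => iteratedDeriv k f, ∑ k ∈ Finset.range 5, |A k|, by positivity, hd, ?_, ?_, ?_,
    ?_⟩
  · intro k hk u
    exact ((hA k u).trans (le_abs_self _)).trans
      (Finset.single_le_sum (f := fun k => |A k|) (fun _ _ => abs_nonneg _)
        (Finset.mem_range.2 (by omega)))
  · intro u hu
    exact Real.smoothTransition.one_of_one_le (by linarith)
  · intro u hu
    exact Real.smoothTransition.zero_of_nonpos (by linarith)
  · exact fun u => ⟨Real.smoothTransition.nonneg _, Real.smoothTransition.le_one _⟩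

/-! ### Convolution powers and the Lindeberg replacement argument -/

section convPow

variable {E : Type*} [NormedAddCommGroup E] [NormedSpace ℝ E] [MeasurableSpace E] [BorelSpace E]
  [SecondCountableTopology E]

/-- The `n`-fold convolution power of a measure. -/
def convPow (ν : Measure E) : ℕ → Measure E
  | 0 => Measure.dirac 0
  | n + 1 => convPow ν n ∗ ν

instance isProbabilityMeasure_convPow (ν : Measure E) [IsProbabilityMeasure ν] (n : ℕ) :
    IsProbabilityMeasure (convPow ν n) := by
  induction n with
  | zero => unfold convPow; infer_instance
  | succ n ih => unfold convPow; infer_instance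

lemma charFunDual_convPow (ν : Measure E) [IsProbabilityMeasure ν] (n : ℕ)
    (L : StrongDual ℝ E) : charFunDual (convPow ν n) L = charFunDual ν L ^ n := by
  induction n with
  | zero => simp [convPow, charFunDual_dirac]
  | succ n ih => rw [convPow, charFunDual_conv, ih, pow_succ]

lemma map_sum_pi_eq_convPow [CompleteSpace E] (ν : Measure E) [IsProbabilityMeasure ν] (n : ℕ) :
    (Measure.pi fun _ : Fin n => ν).map (fun p => ∑ i, p i) = convPow ν n := by
  have : IsProbabilityMeasure ((Measure.pi fun _ : Fin n => ν).map (fun p => ∑ i, p i)) :=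
    Measure.isProbabilityMeasure_map (by fun_prop)
  refine Measure.ext_of_charFunDual ?_
  rw [charFunDual_map_sum_pi_eq_prod]
  ext L
  simp [charFunDual_convPow]

lemma abs_integral_conv_sub_le {ρ ν ν' : Measure E} [IsProbabilityMeasure ρ]
    [IsProbabilityMeasure ν] [IsProbabilityMeasure ν'] {f : E → ℝ} (hf : Measurable f) {K δ : ℝ}
    (hK : ∀ x, |f x| ≤ K) (hδ : ∀ x, |∫ y, f (x + y) ∂ν - ∫ y, f (x + y) ∂ν'| ≤ δ) :
    |∫ x, f x ∂(ρ ∗ ν) - ∫ x, f x ∂(ρ ∗ ν')| ≤ δ := by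
  have hi : ∀ (κ : Measure E) [IsProbabilityMeasure κ], Integrable f κ := fun κ _ =>
    Integrable.of_bound hf.aestronglyMeasurable K (ae_of_all _ hK)
  have hi2 : ∀ (κ : Measure E) [IsProbabilityMeasure κ],
      Integrable (fun x => ∫ y, f (x + y) ∂κ) ρ := fun κ _ => by
    have : Integrable (fun p : E × E => f (p.1 + p.2)) (ρ.prod κ) :=
      Integrable.of_bound (hf.comp (by fun_prop)).aestronglyMeasurable K (ae_of_all _ fun _ => hK _)
    exact this.integral_prod_left
  rw [integral_conv (hi _), integral_conv (hi _), ← integral_sub (hi2 ν) (hi2 ν')]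
  have := norm_integral_le_of_norm_le_const (μ := ρ)
    (f := fun x => ∫ y, f (x + y) ∂ν - ∫ y, f (x + y) ∂ν') (ae_of_all _ hδ)
  simpa using this

lemma abs_integral_convPow_sub_le {ν ν' : Measure E}
    [IsProbabilityMeasure ν] [IsProbabilityMeasure ν'] {f : E → ℝ} (hf : Measurable f) {K δ : ℝ}
    (hK : ∀ x, |f x| ≤ K) (hδ : ∀ x, |∫ y, f (x + y) ∂ν - ∫ y, f (x + y) ∂ν'| ≤ δ) (n : ℕ) :
    |∫ x, f x ∂(convPow ν n) - ∫ x, f x ∂(convPow ν' n)| ≤ n * δ := by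
  suffices H : ∀ (ρ : Measure E) [IsProbabilityMeasure ρ],
      |∫ x, f x ∂(ρ ∗ convPow ν n) - ∫ x, f x ∂(ρ ∗ convPow ν' n)| ≤ n * δ by
    simpa using H (Measure.dirac 0)
  induction n with
  | zero => intro ρ _; simp [convPow]
  | succ n ih =>
    intro ρ _
    have h1 := abs_integral_conv_sub_le (ρ := ρ ∗ convPow ν n) hf hK hδ
    have h2 := ih (ρ ∗ ν')
    simp only [convPow]
    rw [← Measure.conv_assoc, ← Measure.conv_assoc]
    have e : ∀ κ : Measure E, [IsProbabilityMeasure κ] →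
        (ρ ∗ κ) ∗ ν' = (ρ ∗ ν') ∗ κ := fun κ _ => by
      rw [Measure.conv_assoc, Measure.conv_comm κ, Measure.conv_assoc]
    rw [e (convPow ν' n)]
    rw [e (convPow ν n)] at h1
    push_cast
    calc _ ≤ _ := abs_sub_le _ (∫ x, f x ∂((ρ ∗ ν') ∗ convPow ν n)) _
      _ ≤ δ + n * δ := add_le_add h1 h2
      _ = _ := by ring

lemma IsGaussian.convPow_map_smul_eq [CompleteSpace E] (γ : Measure E) [IsGaussian γ]
    (hγ : γ[id] = 0) {n : ℕ} (hn : n ≠ 0) :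
    convPow (γ.map (fun y => (√n : ℝ)⁻¹ • y)) n = γ := by
  have hm : Measurable fun y : E => (√n : ℝ)⁻¹ • y := by fun_prop
  have : IsProbabilityMeasure (γ.map (fun y => (√n : ℝ)⁻¹ • y)) :=
    Measure.isProbabilityMeasure_map hm.aemeasurable
  refine Measure.ext_of_charFunDual ?_
  ext L
  have e : (fun y : E => (√n : ℝ)⁻¹ • y)
      = (((√n : ℝ)⁻¹ • ContinuousLinearMap.id ℝ E : E →L[ℝ] E) : E → E) := by
    ext; simp
  rw [charFunDual_convPow, e, charFunDual_map, IsGaussian.charFunDual_eq_of_integral_eq_zero hγ,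
    IsGaussian.charFunDual_eq_of_integral_eq_zero hγ, ← Complex.exp_nat_mul]
  congr 1
  have e2 : (L.comp ((√n : ℝ)⁻¹ • ContinuousLinearMap.id ℝ E) : E → ℝ)
      = fun y => (√n : ℝ)⁻¹ * L y := by
    ext; simp
  rw [e2, variance_const_mul]
  have : (n : ℂ) ≠ 0 := by exact_mod_cast hn
  rw [inv_pow, Real.sq_sqrt (by positivity)]
  push_cast
  field_simp

end convPow

/-! ### One replacement step -/

section lindeberg

variable {ι : Type*} [Fintype ι]

lemma lineDerivTwo_eq_sum (g : ℕ → ℝ → ℝ) (β : ℝ) (x : ι → ℝ) :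
    ∃ c : ι → ι → ℝ, ∀ y, lineDerivTwo g β x y = ∑ j, ∑ k, c j k * (y j * y k) := by
  classical
  set w : ι → ℝ := fun j => Real.exp (β * x j) / ∑ j, Real.exp (β * x j) with hw
  have h : ∀ (y : ι → ℝ) k, softMoment β x y k = ∑ j, w j * y j ^ k := fun y k => by
    rw [softMoment, Finset.sum_div]
    exact Finset.sum_congr rfl fun j _ => by rw [hw]; ring
  refine ⟨fun j k => (g 2 (smoothMax β x) - β * g 1 (smoothMax β x)) * (w j * w k)
    + (if j = k then β * g 1 (smoothMax β x) * w j else 0), fun y => ?_⟩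
  simp only [add_mul, Finset.sum_add_distrib, ite_mul, zero_mul, Finset.sum_ite_eq,
    Finset.mem_univ, if_true]
  have h1 : ∑ j, ∑ k, (g 2 (smoothMax β x) - β * g 1 (smoothMax β x)) * (w j * w k) * (y j * y k)
      = (g 2 (smoothMax β x) - β * g 1 (smoothMax β x)) * (∑ j, w j * y j) ^ 2 := by
    rw [sq, Finset.sum_mul_sum, Finset.mul_sum]
    refine Finset.sum_congr rfl fun j _ => ?_
    rw [Finset.mul_sum]
    exact Finset.sum_congr rfl fun k _ => by ring
  have h2 : ∑ j, β * g 1 (smoothMax β x) * w j * (y j * y j)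
      = β * g 1 (smoothMax β x) * ∑ j, w j * y j ^ 2 := by
    rw [Finset.mul_sum]
    exact Finset.sum_congr rfl fun k _ => by ring
  rw [h1, h2, lineDerivTwo, h, h]
  simp only [pow_one]
  ring

lemma integrable_lineDerivTwo {Ω : Type*} [MeasurableSpace Ω] {μ : Measure Ω} {Y : Ω → ι → ℝ}
    (h : ∀ j k, Integrable (fun ω => Y ω j * Y ω k) μ) (g : ℕ → ℝ → ℝ) (β : ℝ) (x : ι → ℝ) :
    Integrable (fun ω => lineDerivTwo g β x (Y ω)) μ := by
  obtain ⟨c, hc⟩ := lineDerivTwo_eq_sum g β x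
  simp only [hc]
  exact integrable_finsetSum _ fun j _ => integrable_finsetSum _ fun k _ => (h j k).const_mul _

lemma integral_lineDerivTwo_congr {Ω Ω' : Type*} [MeasurableSpace Ω] [MeasurableSpace Ω']
    {μ : Measure Ω} {μ' : Measure Ω'} {Y : Ω → ι → ℝ} {Y' : Ω' → ι → ℝ}
    (h : ∀ j k, Integrable (fun ω => Y ω j * Y ω k) μ)
    (h' : ∀ j k, Integrable (fun ω => Y' ω j * Y' ω k) μ')
    (he : ∀ j k, ∫ ω, Y ω j * Y ω k ∂μ = ∫ ω, Y' ω j * Y' ω k ∂μ')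
    (g : ℕ → ℝ → ℝ) (β : ℝ) (x : ι → ℝ) :
    ∫ ω, lineDerivTwo g β x (Y ω) ∂μ = ∫ ω, lineDerivTwo g β x (Y' ω) ∂μ' := by
  obtain ⟨c, hc⟩ := lineDerivTwo_eq_sum g β x
  simp only [hc]
  rw [integral_finsetSum _ fun j _ => integrable_finsetSum _ fun k _ => (h j k).const_mul _,
    integral_finsetSum _ fun j _ => integrable_finsetSum _ fun k _ => (h' j k).const_mul _]
  refine Finset.sum_congr rfl fun j _ => ?_
  rw [integral_finsetSum _ fun k _ => (h j k).const_mul _,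
    integral_finsetSum _ fun k _ => (h' j k).const_mul _]
  refine Finset.sum_congr rfl fun k _ => ?_
  rw [integral_const_mul, integral_const_mul, he]

variable [Nonempty ι]

lemma measurable_comp_smoothMax {g : ℕ → ℝ → ℝ} (hg : ∀ k u, HasDerivAt (g k) (g (k + 1) u) u)
    {β : ℝ} : Measurable fun x : ι → ℝ => g 0 (smoothMax β x) :=
  ((continuous_iff_continuousAt.2 fun u => (hg 0 u).continuousAt).comp
    (continuous_smoothMax β)).measurable

section
variable {g : ℕ → ℝ → ℝ} (hg : ∀ k u, HasDerivAt (g k) (g (k + 1) u) u) {A ψ β : ℝ} (hA : 0 ≤ A)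
  (hψ : 0 < ψ) (hψβ : ψ ≤ β) (hgb : ∀ k ≤ 4, ∀ u, |g k u| ≤ A * ψ ^ k)
include hg hA hψ hψβ hgb

lemma abs_comp_smoothMax_taylor_two_le {x y : ι → ℝ} {b : ℝ} (hb : 0 ≤ b) (hy : ∀ j, |y j| ≤ b) :
    |g 0 (smoothMax β (x + y)) - (g 0 (smoothMax β x) + lineDerivOne g β x y
      + lineDerivTwo g β x y / 2)| ≤ 13 * A * (ψ * β ^ 2) * b ^ 3 := by
  have hβ := hψ.trans_le hψβ
  have := abs_taylor_two_le (f := fun θ => g 0 (smoothMax β (x + θ • y)))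
    (hasDerivAt_comp_smoothMax hg hβ x y · 0)
    (hasDerivAt_lineDerivOne hg hβ x y) (hasDerivAt_lineDerivTwo hg hβ x y)
    (fun θ _ => abs_lineDerivThree_le hA hψ hψβ hgb hb hy) (x := 1) (by simp)
  simpa [lineDerivOne] using this

lemma abs_comp_smoothMax_taylor_three_le {x y : ι → ℝ} {b : ℝ} (hy : ∀ j, |y j| ≤ b) :
    |g 0 (smoothMax β (x + y)) - (g 0 (smoothMax β x) + lineDerivOne g β x y
      + lineDerivTwo g β x y / 2 + lineDerivThree g β x y / 6)|
      ≤ 75 * A * (ψ * β ^ 3) * b ^ 4 := by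
  have hβ := hψ.trans_le hψβ
  have := abs_taylor_three_le (f := fun θ => g 0 (smoothMax β (x + θ • y)))
    (hasDerivAt_comp_smoothMax hg hβ x y · 0)
    (hasDerivAt_lineDerivOne hg hβ x y) (hasDerivAt_lineDerivTwo hg hβ x y)
    (hasDerivAt_lineDerivThree hg hβ x y)
    (fun θ _ => abs_lineDerivFour_le hA hψ hψβ hgb hy)
  simpa [lineDerivOne] using this

lemma abs_comp_smoothMax_symm_taylor_le {x y : ι → ℝ} {b : ℝ} (hy : ∀ j, |y j| ≤ b) :
    |(g 0 (smoothMax β (x + y)) + g 0 (smoothMax β (x - y))) / 2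
      - (g 0 (smoothMax β x) + lineDerivTwo g β x y / 2)| ≤ 75 * A * (ψ * β ^ 3) * b ^ 4 := by
  have h1 := abs_comp_smoothMax_taylor_three_le hg hA hψ hψβ hgb (x := x) hy
  have h2 := abs_comp_smoothMax_taylor_three_le hg hA hψ hψβ hgb (x := x) (y := -y) (b := b)
    (by simpa using hy)
  have e1 : lineDerivOne g β x (-y) = - lineDerivOne g β x y := by
    simp [lineDerivOne, softMoment_neg]
  have e2 : lineDerivTwo g β x (-y) = lineDerivTwo g β x y := by
    simp [lineDerivTwo, softMoment_neg]
  have e3 : lineDerivThree g β x (-y) = - lineDerivThree g β x y := by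
    simp [lineDerivThree, softMoment_neg]; ring
  rw [e1, e2, e3, ← sub_eq_add_neg] at h2
  rw [abs_le] at *
  constructor <;> linarith [h1.1, h1.2, h2.1, h2.2]

lemma abs_integral_comp_smoothMax_sub_le_of_bounded {Ω : Type*} [MeasurableSpace Ω]
    {μ : Measure Ω} [IsProbabilityMeasure μ] {X : Ω → ι → ℝ} (hX : Measurable X) {b : ℝ}
    (hb : 0 ≤ b) (hXb : ∀ᵐ ω ∂μ, ∀ j, |X ω j| ≤ b) (hX0 : ∀ j, ∫ ω, X ω j ∂μ = 0) (x : ι → ℝ) :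
    |∫ ω, g 0 (smoothMax β (x + X ω)) ∂μ
      - (g 0 (smoothMax β x) + (∫ ω, lineDerivTwo g β x (X ω) ∂μ) / 2)|
      ≤ 13 * A * (ψ * β ^ 2) * b ^ 3 := by
  have hmeas : ∀ j, Measurable fun ω => X ω j := fun j => (measurable_pi_apply j).comp hX
  have hi1 : ∀ j, Integrable (fun ω => X ω j) μ := fun j =>
    Integrable.of_bound (hmeas j).aestronglyMeasurable b (hXb.mono fun ω h => h j)
  have hi2 : ∀ j k, Integrable (fun ω => X ω j * X ω k) μ := fun j k =>
    Integrable.of_bound ((hmeas j).mul (hmeas k)).aestronglyMeasurable (b * b)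
      (hXb.mono fun ω h => abs_mul_le_of_le (h j) (h k))
  have hone : ∀ ω, lineDerivOne g β x (X ω) = ∑ j, (g 1 (smoothMax β x)
      * (Real.exp (β * x j) / ∑ j, Real.exp (β * x j))) * X ω j := fun ω => by
    rw [lineDerivOne, softMoment, Finset.sum_div, Finset.mul_sum]
    exact Finset.sum_congr rfl fun j _ => by ring
  have hi3 : Integrable (fun ω => lineDerivOne g β x (X ω)) μ := by
    simp only [hone]
    exact integrable_finsetSum _ fun j _ => (hi1 j).const_mul _
  have h3 : ∫ ω, lineDerivOne g β x (X ω) ∂μ = 0 := by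
    simp only [hone]
    rw [integral_finsetSum _ fun j _ => (hi1 j).const_mul _]
    simp [integral_const_mul, hX0]
  have hi0 : Integrable (fun ω => g 0 (smoothMax β (x + X ω))) μ :=
    Integrable.of_bound ((measurable_comp_smoothMax (β := β) hg).comp
      (measurable_const.add hX)).aestronglyMeasurable (A * ψ ^ 0)
      (ae_of_all _ fun ω => hgb 0 (by norm_num) _)
  have hi4 := integrable_lineDerivTwo hi2 g β x
  have := norm_integral_le_of_norm_le_const (μ := μ)
    (f := fun ω => g 0 (smoothMax β (x + X ω)) - (g 0 (smoothMax β x) + lineDerivOne g β x (X ω)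
      + lineDerivTwo g β x (X ω) / 2)) (hXb.mono fun ω h =>
    abs_comp_smoothMax_taylor_two_le hg hA hψ hψβ hgb (x := x) hb h)
  have e : ∫ ω, (g 0 (smoothMax β (x + X ω)) - (g 0 (smoothMax β x) + lineDerivOne g β x (X ω)
      + lineDerivTwo g β x (X ω) / 2)) ∂μ = ∫ ω, g 0 (smoothMax β (x + X ω)) ∂μ
      - (g 0 (smoothMax β x) + (∫ ω, lineDerivTwo g β x (X ω) ∂μ) / 2) := by
    have i5 : Integrable (fun ω => g 0 (smoothMax β x) + lineDerivOne g β x (X ω)) μ :=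
      (integrable_const _).add hi3
    have i6 : Integrable (fun ω => g 0 (smoothMax β x) + lineDerivOne g β x (X ω)
        + lineDerivTwo g β x (X ω) / 2) μ := i5.add (hi4.div_const 2)
    rw [integral_sub hi0 i6, integral_add i5 (hi4.div_const 2), integral_add (integrable_const _) hi3, h3, integral_div]
    simp
  rw [e] at this
  simpa using this

lemma abs_integral_comp_smoothMax_sub_le_of_symm {γ : Measure (ι → ℝ)} [IsProbabilityMeasure γ]
    (hγ : γ.map (fun y => -y) = γ) (h4 : Integrable (fun y => ‖y‖ ^ 4) γ)
    (hi2 : ∀ j k, Integrable (fun y => y j * y k) γ) (x : ι → ℝ) :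
    |∫ y, g 0 (smoothMax β (x + y)) ∂γ
      - (g 0 (smoothMax β x) + (∫ y, lineDerivTwo g β x y ∂γ) / 2)|
      ≤ 75 * A * (ψ * β ^ 3) * ∫ y, ‖y‖ ^ 4 ∂γ := by
  have hm := measurable_comp_smoothMax (ι := ι) (β := β) hg
  have hi0 : ∀ X : (ι → ℝ) → (ι → ℝ), Measurable X →
      Integrable (fun y => g 0 (smoothMax β (X y))) γ := fun X hX =>
    Integrable.of_bound (hm.comp hX).aestronglyMeasurable (A * ψ ^ 0)
      (ae_of_all _ fun ω => hgb 0 (by norm_num) _)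
  have hneg : ∫ y, g 0 (smoothMax β (x + y)) ∂γ = ∫ y, g 0 (smoothMax β (x - y)) ∂γ := by
    conv_lhs => rw [← hγ]
    have hmx : Measurable fun y => g 0 (smoothMax β (x + y)) := hm.comp (by fun_prop)
    rw [integral_map measurable_neg.aemeasurable hmx.aestronglyMeasurable]
    simp [sub_eq_add_neg]
  have hi4 := integrable_lineDerivTwo (Y := fun y => y) hi2 g β x
  have h := norm_integral_le_of_norm_le (μ := γ)
    (f := fun y => (g 0 (smoothMax β (x + y)) + g 0 (smoothMax β (x - y))) / 2
      - (g 0 (smoothMax β x) + lineDerivTwo g β x y / 2)) (h4.const_mul (75 * A * (ψ * β ^ 3)))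
    (ae_of_all _ fun y => abs_comp_smoothMax_symm_taylor_le hg hA hψ hψβ hgb (x := x)
      (y := y) (fun j => norm_le_pi_norm y j))
  rw [integral_const_mul] at h
  have i1 := hi0 (fun y => x + y) (by fun_prop)
  have i2 := hi0 (fun y => x - y) (by fun_prop)
  have i3 : Integrable (fun y => (g 0 (smoothMax β (x + y)) + g 0 (smoothMax β (x - y))) / 2) γ :=
    (i1.add i2).div_const 2
  have i4 : Integrable (fun y => g 0 (smoothMax β x) + lineDerivTwo g β x y / 2) γ :=
    (integrable_const _).add (hi4.div_const 2)
  rw [integral_sub i3 i4, integral_div, integral_add i1 i2, ← hneg, integral_add (integrable_const _) (hi4.div_const 2),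
    integral_div] at h
  simpa using h

/-- **Lindeberg comparison** for smooth functions of the smooth maximum. -/
theorem abs_integral_comp_smoothMax_sum_sub_gaussian_le {Ω : Type*} [MeasurableSpace Ω]
    {P : Measure Ω} [IsProbabilityMeasure P] {X : Ω → ι → ℝ} (hX : Measurable X) {B : ℝ}
    (hB : 0 ≤ B) (hXB : ∀ᵐ ω ∂P, ∀ j, |X ω j| ≤ B) (hX0 : ∀ j, ∫ ω, X ω j ∂P = 0)
    {γ : Measure (ι → ℝ)} [IsGaussian γ] (hγ : γ[id] = 0)
    (hcov : ∀ j k, ∫ y, y j * y k ∂γ = ∫ ω, X ω j * X ω k ∂P) {n : ℕ} (hn : n ≠ 0) :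
    |∫ l, g 0 (smoothMax β ((√n : ℝ)⁻¹ • ∑ i, X (l i))) ∂(Measure.pi fun _ : Fin n => P)
      - ∫ y, g 0 (smoothMax β y) ∂γ|
    ≤ n * (13 * A * (ψ * β ^ 2) * ((√n)⁻¹ * B) ^ 3
        + 75 * A * (ψ * β ^ 3) * ((√n)⁻¹ ^ 4 * ∫ y, ‖y‖ ^ 4 ∂γ)) := by
  set s : ℝ := (√n)⁻¹ with hs
  have hs0 : 0 ≤ s := by positivity
  have hm := measurable_comp_smoothMax (ι := ι) (β := β) hg
  have hsX : Measurable fun ω => s • X ω := by fun_prop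
  set ν := P.map fun ω => s • X ω with hν
  set γ' := γ.map fun y => s • y with hγ'
  have : IsProbabilityMeasure ν := Measure.isProbabilityMeasure_map hsX.aemeasurable
  have : IsProbabilityMeasure γ' := Measure.isProbabilityMeasure_map (by fun_prop)
  have hcont : ∀ x, Measurable fun y : ι → ℝ => g 0 (smoothMax β (x + y)) := fun x =>
    hm.comp (by fun_prop)
  have hL : ∫ l, g 0 (smoothMax β (s • ∑ i, X (l i))) ∂(Measure.pi fun _ : Fin n => P)
      = ∫ x, g 0 (smoothMax β x) ∂(convPow ν n) := by
    rw [← map_sum_pi_eq_convPow ν n, hν]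
    have : Measure.pi (fun _ : Fin n => P.map fun ω => s • X ω)
        = (Measure.pi fun _ : Fin n => P).map (fun l i => s • X (l i)) :=
      (Measure.pi_map_pi (fun _ => hsX.aemeasurable)).symm
    have hl : Measurable fun (l : Fin n → Ω) (i : Fin n) => s • X (l i) :=
      measurable_pi_lambda _ fun i => hsX.comp (measurable_pi_apply i)
    have hsum : Measurable fun p : Fin n → ι → ℝ => ∑ i, p i := by fun_prop
    rw [this, Measure.map_map hsum hl,
      integral_map (hsum.comp hl).aemeasurable hm.aestronglyMeasurable]
    simp [Finset.smul_sum]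
  have hG : ∫ y, g 0 (smoothMax β y) ∂γ = ∫ x, g 0 (smoothMax β x) ∂(convPow γ' n) := by
    rw [hγ', hs, IsGaussian.convPow_map_smul_eq γ hγ hn]
  rw [hL, hG]
  refine abs_integral_convPow_sub_le hm (K := A * ψ ^ 0) (fun x => hgb 0 (by norm_num) _)
    (fun x => ?_) n
  have hmem : MemLp id 4 γ := IsGaussian.memLp_id γ 4 (by norm_num)
  have hmem2 : MemLp id 2 γ := IsGaussian.memLp_id γ 2 (by norm_num)
  have h4 : Integrable (fun y : ι → ℝ => ‖y‖ ^ 4) γ := by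
    simpa using hmem.integrable_norm_pow (by norm_num)
  have hi2 : ∀ j k, Integrable (fun y : ι → ℝ => y j * y k) γ := fun j k => by
    have h2 : Integrable (fun y : ι → ℝ => ‖y‖ ^ 2) γ := by
      simpa using hmem2.integrable_norm_pow (by norm_num)
    refine h2.mono' (by fun_prop) (ae_of_all _ fun y => ?_)
    rw [norm_mul, sq]
    exact mul_le_mul (norm_le_pi_norm _ _) (norm_le_pi_norm _ _) (norm_nonneg _) (norm_nonneg _)
  have hsymm : γ.map (fun y => -y) = γ := by
    refine Measure.ext_of_charFunDual ?_
    ext L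
    have e : (fun y : ι → ℝ => -y)
        = ((-ContinuousLinearMap.id ℝ (ι → ℝ) : (ι → ℝ) →L[ℝ] (ι → ℝ)) : (ι → ℝ) → (ι → ℝ)) := by
      ext; simp
    rw [e, charFunDual_map, IsGaussian.charFunDual_eq_of_integral_eq_zero hγ,
      IsGaussian.charFunDual_eq_of_integral_eq_zero hγ]
    have e2 : (L.comp (-ContinuousLinearMap.id ℝ (ι → ℝ)) : (ι → ℝ) → ℝ) = -L := by
      ext; simp
    rw [e2, variance_neg]
  have hsymm' : γ'.map (fun y => -y) = γ' := by
    rw [hγ', Measure.map_map (by fun_prop) (by fun_prop)]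
    conv_rhs => rw [← hsymm, Measure.map_map (by fun_prop) (by fun_prop)]
    congr 1
    ext y; simp
  have h4' : Integrable (fun y : ι → ℝ => ‖y‖ ^ 4) γ' := by
    rw [hγ', integrable_map_measure (by fun_prop) (by fun_prop)]
    refine (h4.const_mul (s ^ 4)).congr (ae_of_all _ fun y => ?_)
    simp [norm_smul, mul_pow, abs_of_nonneg hs0]
  have hi2' : ∀ j k, Integrable (fun y : ι → ℝ => y j * y k) γ' := fun j k => by
    rw [hγ', integrable_map_measure (by fun_prop) (by fun_prop)]
    refine ((hi2 j k).const_mul (s ^ 2)).congr (ae_of_all _ fun y => ?_)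
    simp; ring
  have hXi2 : ∀ j k, Integrable (fun ω => (s • X ω) j * (s • X ω) k) P := fun j k =>
    Integrable.of_bound (by fun_prop) ((s * B) * (s * B)) (hXB.mono fun ω h => by
      have : ∀ j, |(s • X ω) j| ≤ s * B := fun j => by
        simpa [abs_mul, abs_of_nonneg hs0] using mul_le_mul_of_nonneg_left (h j) hs0
      exact abs_mul_le_of_le (this j) (this k))
  have hstep1 := abs_integral_comp_smoothMax_sub_le_of_bounded hg hA hψ hψβ hgb (μ := P)
    hsX (b := s * B) (by positivity) (hXB.mono fun ω h j => by
      simpa [abs_mul, abs_of_nonneg hs0] using mul_le_mul_of_nonneg_left (h j) hs0)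
    (fun j => by simp [integral_const_mul, hX0]) x
  have hstep2 := abs_integral_comp_smoothMax_sub_le_of_symm hg hA hψ hψβ hgb hsymm' h4' hi2' x
  have e1 : ∫ y, g 0 (smoothMax β (x + y)) ∂ν = ∫ ω, g 0 (smoothMax β (x + s • X ω)) ∂P := by
    rw [hν, integral_map hsX.aemeasurable (hcont x).aestronglyMeasurable]
  have e2 : ∫ ω, lineDerivTwo g β x (s • X ω) ∂P = ∫ y, lineDerivTwo g β x y ∂γ' := by
    refine integral_lineDerivTwo_congr hXi2 hi2' (fun j k => ?_) g β x
    rw [hγ', integral_map (by fun_prop) (by fun_prop)]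
    have : ∀ a b : ℝ, s * a * (s * b) = s ^ 2 * (a * b) := fun a b => by ring
    simp only [Pi.smul_apply, smul_eq_mul, this, integral_const_mul, hcov]
  have e3 : ∫ y, ‖y‖ ^ 4 ∂γ' = s ^ 4 * ∫ y, ‖y‖ ^ 4 ∂γ := by
    rw [hγ', integral_map (by fun_prop) (by fun_prop)]
    simp [norm_smul, mul_pow, abs_of_nonneg hs0, integral_const_mul]
  rw [e1]
  rw [e2] at hstep1
  rw [e3] at hstep2
  rw [abs_sub_comm] at hstep2
  exact (abs_sub_le _ _ _).trans (add_le_add hstep1 hstep2)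

end

end lindeberg

/-! ### One-dimensional Gaussian estimates -/

lemma gaussianReal_Icc_le (v η : ℝ) :
    gaussianReal 0 1 (Icc v (v + η))
      ≤ ENNReal.ofReal (gaussianPDFReal 0 1 (max v 0)) * ENNReal.ofReal η := by
  rw [gaussianReal_apply 0 one_ne_zero]
  calc ∫⁻ x in Icc v (v + η), gaussianPDF 0 1 x
      ≤ ∫⁻ _ in Icc v (v + η), ENNReal.ofReal (gaussianPDFReal 0 1 (max v 0)) := by
        refine setLIntegral_mono measurable_const fun x hx => ?_
        refine ENNReal.ofReal_le_ofReal ?_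
        simp only [gaussianPDFReal_def]
        have h : max v 0 ^ 2 ≤ x ^ 2 := by
          rcases le_total v 0 with h | h
          · simp [max_eq_right h, sq_nonneg]
          · rw [max_eq_left h]
            have := hx.1
            gcongr
        simp only [sub_zero]
        gcongr
    _ = _ := by simp

lemma le_gaussianReal_Ioi {v b : ℝ} (hb : 1 ≤ b) (hv : v ≤ b) :
    ENNReal.ofReal (Real.exp (-(3 / 2)) * gaussianPDFReal 0 1 (max v 0)) * ENNReal.ofReal b⁻¹
      ≤ gaussianReal 0 1 (Ioi v) := by
  have hb0 : 0 < b := by linarith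
  set u := max v 0 with hu
  have hu0 : 0 ≤ u := le_max_right _ _
  have hub : u ≤ b := max_le hv hb0.le
  calc _ = ∫⁻ _ in Ioc u (u + b⁻¹),
        ENNReal.ofReal (Real.exp (-(3 / 2)) * gaussianPDFReal 0 1 u) := by simp
    _ ≤ ∫⁻ x in Ioc u (u + b⁻¹), gaussianPDF 0 1 x := by
        refine setLIntegral_mono (measurable_gaussianPDF 0 1) fun x hx => ?_
        refine ENNReal.ofReal_le_ofReal ?_
        simp only [gaussianPDFReal_def, NNReal.coe_one, mul_one, sub_zero]
        rw [mul_left_comm, ← Real.exp_add]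
        gcongr
        have h1 : x ^ 2 ≤ (u + b⁻¹) ^ 2 := by
          have := hx.1; have := hx.2
          gcongr
          linarith
        have h2 : u * b⁻¹ ≤ 1 := by
          rw [← div_eq_mul_inv]; exact (div_le_one hb0).2 hub
        have h3 : b⁻¹ ≤ 1 := inv_le_one_of_one_le₀ hb
        have h4 : 0 ≤ b⁻¹ := by positivity
        nlinarith
    _ = gaussianReal 0 1 (Ioc u (u + b⁻¹)) := (gaussianReal_apply 0 one_ne_zero _).symm
    _ ≤ _ := measure_mono fun x hx => lt_of_le_of_lt (le_max_left _ _) hx.1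

/-- For an upper set, the standard Gaussian mass close to a level is controlled by the mass above
that level. -/
lemma gaussianReal_inter_Ioc_le {A : Set ℝ} (hA : IsUpperSet A) {a η b : ℝ} (hη : 0 ≤ η)
    (hb : 1 ≤ b) (hab : a + η ≤ b) :
    gaussianReal 0 1 (A ∩ Ioc a (a + η))
      ≤ ENNReal.ofReal (Real.exp (3 / 2) * b * η) * gaussianReal 0 1 (A ∩ Ioi a) := by
  rcases (A ∩ Ioc a (a + η)).eq_empty_or_nonempty with h0 | ⟨x₀, hx₀⟩
  · simp [h0]
  have hb0 : 0 < b := by linarith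
  have hne : (A ∩ Ioi a).Nonempty := ⟨x₀, hx₀.1, hx₀.2.1⟩
  have hbdd : BddBelow (A ∩ Ioi a) := ⟨a, fun x hx => hx.2.le⟩
  set v := sInf (A ∩ Ioi a) with hv
  have hav : a ≤ v := le_csInf hne fun x hx => hx.2.le
  have hvx : v ≤ x₀ := csInf_le hbdd ⟨hx₀.1, hx₀.2.1⟩
  have hvb : v ≤ b := hvx.trans (hx₀.2.2.trans hab)
  have hsub : Ioi v ⊆ A ∩ Ioi a := fun x hx => by
    obtain ⟨y, hy, hyx⟩ := exists_lt_of_csInf_lt hne hx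
    exact ⟨hA hyx.le hy.1, lt_of_le_of_lt hav hx⟩
  calc gaussianReal 0 1 (A ∩ Ioc a (a + η))
      ≤ gaussianReal 0 1 (Icc v (v + η)) := measure_mono fun x hx =>
        ⟨csInf_le hbdd ⟨hx.1, hx.2.1⟩, by linarith [hx.2.2]⟩
    _ ≤ ENNReal.ofReal (gaussianPDFReal 0 1 (max v 0)) * ENNReal.ofReal η :=
        gaussianReal_Icc_le v η
    _ = ENNReal.ofReal (Real.exp (3 / 2) * b * η) * (ENNReal.ofReal (Real.exp (-(3 / 2))
          * gaussianPDFReal 0 1 (max v 0)) * ENNReal.ofReal b⁻¹) := by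
        have hp := gaussianPDFReal_nonneg 0 1 (max v 0)
        rw [← ENNReal.ofReal_mul hp, ← ENNReal.ofReal_mul (by positivity),
          ← ENNReal.ofReal_mul (by positivity)]
        congr 1
        rw [Real.exp_neg]
        field_simp
    _ ≤ _ := by gcongr; exact (le_gaussianReal_Ioi hb hvb).trans (measure_mono hsub)

/-! ### Gaussian vectors -/

section vector

variable {ι : Type*} [Fintype ι] {γ : Measure (ι → ℝ)} [IsGaussian γ]

lemma IsGaussian.memLp_eval (j : ι) : MemLp (fun y : ι → ℝ => y j) 2 γ :=
  IsGaussian.memLp_dual γ (ContinuousLinearMap.proj j) 2 (by norm_num)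

lemma IsGaussian.integral_eval (hγ : γ[id] = 0) (j : ι) : ∫ y, y j ∂γ = 0 := by
  have := ContinuousLinearMap.integral_comp_comm
    (ContinuousLinearMap.proj (R := ℝ) (φ := fun _ : ι => ℝ) j) (IsGaussian.integrable_id (μ := γ))
  simp only [id_eq] at hγ this
  simpa [hγ] using this

lemma IsGaussian.variance_eval (hγ : γ[id] = 0) (j : ι) :
    Var[fun y => y j; γ] = ∫ y, y j * y j ∂γ := by
  rw [variance_of_integral_eq_zero (measurable_pi_apply j).aemeasurable (IsGaussian.integral_eval hγ j)]
  simp [sq]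

lemma IsGaussian.map_eval (hγ : γ[id] = 0) (j : ι) :
    γ.map (fun y => y j) = gaussianReal 0 (∫ y, y j * y j ∂γ).toNNReal := by
  have := IsGaussian.map_eq_gaussianReal (μ := γ) (ContinuousLinearMap.proj (R := ℝ)
    (φ := fun _ : ι => ℝ) j)
  rw [← IsGaussian.variance_eval hγ, ← IsGaussian.integral_eval hγ j]
  exact this

lemma IsGaussian.integral_exp_mul_eval_le (hγ : γ[id] = 0) {B : ℝ} {j : ι}
    (hB : ∫ y, y j * y j ∂γ ≤ B ^ 2) (t : ℝ) :
    Integrable (fun y => Real.exp (t * y j)) γ ∧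
      ∫ y, Real.exp (t * y j) ∂γ ≤ Real.exp (B ^ 2 * t ^ 2 / 2) := by
  have hm := IsGaussian.map_eval hγ j
  constructor
  · have := integrable_exp_mul_gaussianReal (μ := 0) (v := (∫ y, y j * y j ∂γ).toNNReal) t
    rw [← hm] at this
    have hj : Measurable fun y : ι → ℝ => y j := measurable_pi_apply j
    exact (integrable_map_measure (by fun_prop) hj.aemeasurable).1 this
  · have := mgf_gaussianReal hm t
    rw [mgf] at this
    rw [this, Real.coe_toNNReal _ (integral_nonneg fun y => mul_self_nonneg _)]
    gcongr
    linarith [mul_le_mul_of_nonneg_right hB (sq_nonneg t)]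

lemma pow_four_le_exp {u : ℝ} (hu : 0 ≤ u) : u ^ 4 ≤ 24 * Real.exp u := by
  have := Real.pow_div_factorial_le_exp u hu 4
  norm_num [Nat.factorial] at this
  linarith

/-- The fourth moment of the maximum of a Gaussian vector grows at most like the fourth power of
the logarithm of the dimension. -/
lemma IsGaussian.integral_norm_pow_four_le [Nonempty ι] (hγ : γ[id] = 0) {B : ℝ}
    (hB : ∀ j, ∫ y, y j * y j ∂γ ≤ B ^ 2) :
    ∫ y, ‖y‖ ^ 4 ∂γ ≤ Real.log (Fintype.card ι) ^ 4 + 48 * Real.exp (2 * B ^ 2) := by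
  set a := Real.log (Fintype.card ι) with ha
  have hcard : (0 : ℝ) < Fintype.card ι := by exact_mod_cast Fintype.card_pos
  have ha0 : 0 ≤ a := Real.log_natCast_nonneg _
  have hea : Real.exp (-a) = (Fintype.card ι : ℝ)⁻¹ := by
    rw [Real.exp_neg, ha, Real.exp_log hcard]
  have hpt : ∀ y : ι → ℝ, ‖y‖ ^ 4 ≤ a ^ 4 + ∑ j, 24 * Real.exp (-a)
      * (Real.exp (2 * y j) + Real.exp (-2 * y j)) := fun y => by
    obtain ⟨j, hj⟩ : ∃ j, ‖y‖ = |y j| := by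
      obtain ⟨j, -, hj⟩ := Finset.exists_mem_eq_sup' Finset.univ_nonempty fun j => ‖y j‖₊
      refine ⟨j, ?_⟩
      rw [Pi.norm_def, ← Finset.sup'_eq_sup Finset.univ_nonempty, hj]
      rfl
    have hs : 0 ≤ ∑ j, 24 * Real.exp (-a) * (Real.exp (2 * y j) + Real.exp (-2 * y j)) := by
      positivity
    rcases le_total ‖y‖ a with h | h
    · have : ‖y‖ ^ 4 ≤ a ^ 4 := by gcongr
      linarith
    · have h1 := Finset.single_le_sum (f := fun j => 24 * Real.exp (-a)
        * (Real.exp (2 * y j) + Real.exp (-2 * y j))) (fun _ _ => by positivity)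
        (Finset.mem_univ j)
      have h2 : Real.exp (2 * ‖y‖) ≤ Real.exp (2 * y j) + Real.exp (-2 * y j) := by
        rw [hj]
        rcases abs_choice (y j) with h' | h' <;> rw [h']
        · linarith [Real.exp_pos (-2 * y j)]
        · rw [mul_neg, ← neg_mul]; linarith [Real.exp_pos (2 * y j)]
      calc ‖y‖ ^ 4 ≤ 24 * Real.exp ‖y‖ := pow_four_le_exp (norm_nonneg _)
        _ ≤ 24 * Real.exp (-a + 2 * ‖y‖) := by gcongr; linarith
        _ = 24 * Real.exp (-a) * Real.exp (2 * ‖y‖) := by rw [Real.exp_add]; ring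
        _ ≤ 24 * Real.exp (-a) * (Real.exp (2 * y j) + Real.exp (-2 * y j)) := by gcongr
        _ ≤ _ := h1
        _ ≤ _ := by linarith [pow_nonneg ha0 4]
  have hi : ∀ j, Integrable (fun y : ι → ℝ => 24 * Real.exp (-a)
      * (Real.exp (2 * y j) + Real.exp (-2 * y j))) γ := fun j =>
    (((IsGaussian.integral_exp_mul_eval_le hγ (hB j) 2).1).add
      ((IsGaussian.integral_exp_mul_eval_le hγ (hB j) (-2)).1)).const_mul _
  have hsum := integrable_finsetSum Finset.univ fun j _ => hi j
  have h4 : Integrable (fun y : ι → ℝ => ‖y‖ ^ 4) γ := by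
    simpa using (IsGaussian.memLp_id γ 4 (by norm_num)).integrable_norm_pow (by norm_num)
  calc ∫ y, ‖y‖ ^ 4 ∂γ ≤ ∫ y, (a ^ 4 + ∑ j, 24 * Real.exp (-a)
      * (Real.exp (2 * y j) + Real.exp (-2 * y j))) ∂γ :=
        integral_mono h4 ((integrable_const _).add hsum) hpt
    _ = a ^ 4 + ∑ j, 24 * Real.exp (-a) * (∫ y, Real.exp (2 * y j) ∂γ
        + ∫ y, Real.exp (-2 * y j) ∂γ) := by
        rw [integral_add (integrable_const _) hsum, integral_finsetSum _ fun j _ => hi j]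
        simp only [integral_const_mul]
        congr 1
        · simp
        · refine Finset.sum_congr rfl fun j _ => ?_
          rw [integral_add (IsGaussian.integral_exp_mul_eval_le hγ (hB j) 2).1
            (IsGaussian.integral_exp_mul_eval_le hγ (hB j) (-2)).1]
    _ ≤ a ^ 4 + ∑ j : ι, 24 * Real.exp (-a) * (Real.exp (2 * B ^ 2) + Real.exp (2 * B ^ 2)) := by
        gcongr with j
        · refine (IsGaussian.integral_exp_mul_eval_le hγ (hB j) 2).2.trans (le_of_eq ?_)
          congr 1; ring
        · refine (IsGaussian.integral_exp_mul_eval_le hγ (hB j) (-2)).2.trans (le_of_eq ?_)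
          congr 1; ring
    _ = _ := by
        rw [Finset.sum_const, Finset.card_univ, nsmul_eq_mul, hea]
        field_simp
        ring

lemma IsGaussian.measureReal_exists_gt_le (hγ : γ[id] = 0) {B : ℝ} (hB0 : 0 < B)
    (hB : ∀ j, ∫ y, y j * y j ∂γ ≤ B ^ 2) {z : ℝ} (hz : 0 ≤ z) :
    γ.real {y | ∃ j, z < y j} ≤ Fintype.card ι * Real.exp (-(z ^ 2 / (2 * B ^ 2))) := by
  have hj : ∀ j, γ.real {y | z < y j} ≤ Real.exp (-(z ^ 2 / (2 * B ^ 2))) := fun j => by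
    obtain ⟨h1, h2⟩ := IsGaussian.integral_exp_mul_eval_le hγ (hB j) (z / B ^ 2)
    have h3 := measure_ge_le_exp_mul_mgf (μ := γ) (X := fun y => y j) z
      (t := z / B ^ 2) (by positivity) h1
    calc γ.real {y | z < y j} ≤ γ.real {y | z ≤ y j} :=
        measureReal_mono fun y (hy : z < y j) => hy.le
      _ ≤ _ := h3
      _ ≤ Real.exp (-(z / B ^ 2) * z) * Real.exp (B ^ 2 * (z / B ^ 2) ^ 2 / 2) := by
          gcongr; exact h2
      _ = _ := by
          rw [← Real.exp_add]
          congr 1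
          field_simp
          ring
  calc γ.real {y | ∃ j, z < y j} = γ.real (⋃ j ∈ Finset.univ, {y : ι → ℝ | z < y j}) := by
        congr 1; ext; simp
    _ ≤ ∑ j, γ.real {y : ι → ℝ | z < y j} := measureReal_biUnion_finset_le _ _
    _ ≤ ∑ j : ι, Real.exp (-(z ^ 2 / (2 * B ^ 2))) := Finset.sum_le_sum fun j _ => hj j
    _ = _ := by simp

end vector

/-! ### Anti-concentration of Gaussian maxima -/

lemma gaussianReal_prod_inter_Ioc_le {F : Type*} [MeasurableSpace F] {ν : Measure F}
    [SFinite ν] {S : Set (ℝ × F)} (hS : MeasurableSet S)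
    (hup : ∀ r, IsUpperSet {u | (u, r) ∈ S}) {a η b : ℝ} (hη : 0 ≤ η)
    (hb : 1 ≤ b) (hab : a + η ≤ b) :
    ((gaussianReal 0 1).prod ν) (S ∩ {q | q.1 ∈ Ioc a (a + η)})
      ≤ ENNReal.ofReal (Real.exp (3 / 2) * b * η) * ((gaussianReal 0 1).prod ν) S := by
  have h1 : MeasurableSet (S ∩ {q : ℝ × F | q.1 ∈ Ioc a (a + η)}) :=
    hS.inter (measurable_fst measurableSet_Ioc)
  rw [Measure.prod_apply_symm h1, Measure.prod_apply_symm hS,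
    ← lintegral_const_mul _ (measurable_measure_prodMk_right hS)]
  refine lintegral_mono fun r => ?_
  exact (gaussianReal_inter_Ioc_le (hup r) hη hb hab).trans (by
    gcongr; exact fun u hu => hu.1)

section vector

variable {ι : Type*} [Fintype ι] {γ : Measure (ι → ℝ)} [IsGaussian γ]

lemma IsGaussian.integrable_eval_mul (j k : ι) : Integrable (fun y => y j * y k) γ :=
  (IsGaussian.memLp_eval j).integrable_mul (IsGaussian.memLp_eval k)

/-- Regressing a standardized Gaussian vector on one of its coordinates leaves a residual which is
independent of this coordinate. -/
lemma IsGaussian.map_prodMk_residual (hγ : γ[id] = 0) {σ : ι → ℝ} (hσ0 : ∀ j, 0 < σ j)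
    (hσ : ∀ j, ∫ y, y j * y j ∂γ = σ j ^ 2) (j : ι) :
    γ.map (fun y => (y j / σ j,
        fun k => y k / σ k - (∫ x, x j * x k ∂γ) / (σ j * σ k) * (y j / σ j)))
      = (gaussianReal 0 1).prod (γ.map fun y k =>
        y k / σ k - (∫ x, x j * x k ∂γ) / (σ j * σ k) * (y j / σ j)) := by
  set ρ : ι → ℝ := fun k => (∫ x, x j * x k ∂γ) / (σ j * σ k) with hρ
  set U : (ι → ℝ) → ℝ := fun y => y j / σ j with hU
  set R : (ι → ℝ) → ι → ℝ := fun y k => y k / σ k - ρ k * (y j / σ j) with hR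
  have hmeas : ∀ k, Measurable fun y : ι → ℝ => y k := fun k => measurable_pi_apply k
  have hUm : Measurable U := (hmeas j).div_const _
  have hRm : Measurable R := measurable_pi_lambda _ fun k =>
    ((hmeas k).div_const _).sub (((hmeas j).div_const _).const_mul _)
  have hlawU : γ.map U = gaussianReal 0 1 := by
    have h1 := IsGaussian.map_eval hγ j
    have : γ.map U = (γ.map fun y => y j).map (fun u => u / σ j) := by
      rw [Measure.map_map (by fun_prop) (hmeas j)]; rfl
    rw [this, h1, gaussianReal_map_div_const, hσ]
    congr 1
    · simp
    · ext
      have := (hσ0 j).ne'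
      simp [this, Real.coe_toNNReal _ (sq_nonneg (σ j))]
  have hind : IndepFun (fun y (_ : Unit) => U y) R γ := by
    refine HasGaussianLaw.indepFun_of_covariance_eval (X := fun _ => U)
      (Y := fun k y => R y k) ?_ fun _ k => ?_
    · let L : (ι → ℝ) →L[ℝ] (Unit → ℝ) × (ι → ℝ) :=
        (ContinuousLinearMap.pi fun _ => (σ j)⁻¹ • ContinuousLinearMap.proj j).prod
          (ContinuousLinearMap.pi fun k => (σ k)⁻¹ • ContinuousLinearMap.proj k
            - (ρ k * (σ j)⁻¹) • ContinuousLinearMap.proj j)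
      have := (IsGaussian.hasGaussianLaw_id (μ := γ)).map_fun L
      have hL : (fun y => L (id y)) = fun y => (fun _ => U y, fun k => R y k) := by
        ext y k
        · simp [L, hU, div_eq_inv_mul]
        · simp [L, hR, div_eq_inv_mul, mul_assoc]
      rw [hL] at this
      exact this
    · have hUL : MemLp U 2 γ := by
        simpa [hU, div_eq_inv_mul] using (IsGaussian.memLp_eval (γ := γ) j).const_mul (σ j)⁻¹
      have hRL : MemLp (fun y => R y k) 2 γ := by
        have := ((IsGaussian.memLp_eval (γ := γ) k).const_mul (σ k)⁻¹).sub (hUL.const_mul (ρ k))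
        refine this.ae_eq (ae_of_all _ fun y => ?_)
        simp [hR, hU, div_eq_inv_mul]
      have hU0 : ∫ y, U y ∂γ = 0 := by
        simp [hU, integral_div, IsGaussian.integral_eval hγ]
      rw [covariance_eq_sub hUL hRL, hU0, zero_mul, sub_zero]
      have e : ∀ y : ι → ℝ, (U * fun y => R y k) y
          = (σ j * σ k)⁻¹ * (y j * y k) - ρ k * (σ j ^ 2)⁻¹ * (y j * y j) := fun y => by
        have h1 := (hσ0 j).ne'
        have h2 := (hσ0 k).ne'
        simp only [Pi.mul_apply, hU, hR]
        field_simp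
      simp only [e]
      rw [integral_sub ((IsGaussian.integrable_eval_mul j k).const_mul _)
        ((IsGaussian.integrable_eval_mul j j).const_mul _), integral_const_mul,
        integral_const_mul, hσ j]
      have h1 := (hσ0 j).ne'
      simp only [hρ]
      field_simp
      ring
  have hind' : IndepFun U R γ :=
    hind.comp (φ := fun f : Unit → ℝ => f ()) (ψ := id) (measurable_pi_apply _) measurable_id
  rw [(indepFun_iff_map_prod_eq_prod_map_map hUm.aemeasurable hRm.aemeasurable).1 hind', hlawU]

lemma IsGaussian.integral_eval_mul_le {σ : ι → ℝ} (hσ0 : ∀ j, 0 < σ j)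
    (hσ : ∀ j, ∫ y, y j * y j ∂γ = σ j ^ 2) (j k : ι) :
    (∫ x, x j * x k ∂γ) / (σ j * σ k) ≤ 1 := by
  have h1 := hσ0 j
  have h2 := hσ0 k
  rw [div_le_one (by positivity)]
  have h : 0 ≤ ∫ y, (σ k * y j - σ j * y k) ^ 2 ∂γ := integral_nonneg fun y => sq_nonneg _
  have e : ∀ y : ι → ℝ, (σ k * y j - σ j * y k) ^ 2 = σ k ^ 2 * (y j * y j)
      - 2 * σ j * σ k * (y j * y k) + σ j ^ 2 * (y k * y k) := fun y => by ring
  have i := fun a b => IsGaussian.integrable_eval_mul (γ := γ) a b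
  have i1 : Integrable (fun y : ι → ℝ => σ k ^ 2 * (y j * y j)
      - 2 * σ j * σ k * (y j * y k)) γ := ((i j j).const_mul _).sub ((i j k).const_mul _)
  simp only [e] at h
  rw [integral_add i1 ((i k k).const_mul _), integral_sub ((i j j).const_mul _)
    ((i j k).const_mul _)] at h
  simp only [integral_const_mul, hσ] at h
  have h3 : 0 < σ j * σ k := by positivity
  nlinarith

/-- Anti-concentration for the maximum of a centred Gaussian vector. -/
theorem IsGaussian.measure_exists_gt_and_forall_le_le (hγ : γ[id] = 0) {σ : ι → ℝ} {c : ℝ}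
    (hc : 0 < c) (hcσ : ∀ j, c ≤ σ j) (hσ : ∀ j, ∫ y, y j * y j ∂γ = σ j ^ 2) (z : ℝ)
    {ε : ℝ} (hε : 0 ≤ ε) :
    γ {y | (∃ j, z < y j) ∧ ∀ j, y j ≤ z + ε}
      ≤ ENNReal.ofReal (Real.exp (3 / 2) * (|z| / c + ε / c + 1) * (ε / c)) := by
  set η := ε / c with hη
  set b := |z| / c + η + 1 with hb
  have hη0 : 0 ≤ η := by positivity
  have hb1 : 1 ≤ b := by have : 0 ≤ |z| / c := by positivity
                         linarith
  have hσ0 : ∀ j, 0 < σ j := fun j => hc.trans_le (hcσ j)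
  set e := Fintype.equivFin ι
  have hmeas : ∀ k, Measurable fun y : ι → ℝ => y k := fun k => measurable_pi_apply k
  let W : ι → (ι → ℝ) → ℝ := fun j y => (y j - z) / σ j
  have hW : ∀ j, Measurable (W j) := fun j => ((hmeas j).sub_const _).div_const _
  let E : ι → Set (ι → ℝ) := fun j => {y | ∀ k, W k y ≤ W j y ∧ (e k < e j → W k y < W j y)}
  have hEm : ∀ j, MeasurableSet (E j) := fun j => by
    have : E j = ⋂ k, ({y | W k y ≤ W j y} ∩ {y | e k < e j → W k y < W j y}) := by
      ext y; simp [E]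
    rw [this]
    refine MeasurableSet.iInter fun k => (measurableSet_le (hW k) (hW j)).inter ?_
    by_cases h : e k < e j
    · simpa [h] using measurableSet_lt (hW k) (hW j)
    · simp [h]
  have hdisj : Pairwise (Function.onFun Disjoint E) := fun j k hjk => by
    refine Set.disjoint_left.2 fun y hj hk => ?_
    rcases lt_trichotomy (e j) (e k) with h | h | h
    · exact absurd ((hk j).2 h) (not_lt.2 (hj k).1)
    · exact hjk (e.injective h)
    · exact absurd ((hj k).2 h) (not_lt.2 (hk j).1)
  have hcover : {y | (∃ j, z < y j) ∧ ∀ j, y j ≤ z + ε}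
      ⊆ ⋃ j, (E j ∩ {y | y j / σ j ∈ Ioc (z / σ j) (z / σ j + η)}) := by
    rintro y ⟨⟨j₀, hj₀⟩, hy⟩
    have : Nonempty ι := ⟨j₀⟩
    obtain ⟨m, hm⟩ := Finite.exists_max fun j => W j y
    obtain ⟨j, hj, hjmin⟩ := Finset.exists_min_image (Finset.univ.filter fun j => W j y = W m y) e
      ⟨m, by simp⟩
    rw [Finset.mem_filter] at hj
    have hjE : y ∈ E j := fun k => by
      refine ⟨by rw [hj.2]; exact hm k, fun hk => ?_⟩
      rw [hj.2]
      refine lt_of_le_of_ne (hm k) fun h => ?_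
      exact absurd (hjmin k (by simpa using h)) (not_le.2 hk)
    refine mem_iUnion.2 ⟨j, hjE, ?_⟩
    have hpos : 0 < W j y := lt_of_lt_of_le (div_pos (sub_pos.2 hj₀) (hσ0 j₀)) (hjE j₀).1
    have hle : W j y ≤ η := by
      calc W j y ≤ ε / σ j := by
            have := hσ0 j
            have := hy j
            simp only [W]
            gcongr
            linarith
        _ ≤ η := div_le_div_of_nonneg_left hε hc (hcσ j)
    simp only [W, sub_div] at hpos hle
    exact ⟨by linarith, by linarith⟩
  have hj : ∀ j, γ (E j ∩ {y | y j / σ j ∈ Ioc (z / σ j) (z / σ j + η)})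
      ≤ ENNReal.ofReal (Real.exp (3 / 2) * b * η) * γ (E j) := fun j => by
    set ρ : ι → ℝ := fun k => (∫ x, x j * x k ∂γ) / (σ j * σ k) with hρ
    have hlaw := IsGaussian.map_prodMk_residual hγ hσ0 hσ j
    set V : (ι → ℝ) → ℝ × (ι → ℝ) := fun y => (y j / σ j, fun k => y k / σ k - ρ k * (y j / σ j))
      with hV
    have hVm : Measurable V := ((hmeas j).div_const _).prodMk (measurable_pi_lambda _ fun k =>
      ((hmeas k).div_const _).sub (((hmeas j).div_const _).const_mul _))
    let S : Set (ℝ × (ι → ℝ)) := {q | ∀ k, q.2 k - z / σ k + z / σ j ≤ (1 - ρ k) * q.1 ∧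
      (e k < e j → q.2 k - z / σ k + z / σ j < (1 - ρ k) * q.1)}
    have hSm : MeasurableSet S := by
      have : S = ⋂ k, ({q | q.2 k - z / σ k + z / σ j ≤ (1 - ρ k) * q.1} ∩
          {q | e k < e j → q.2 k - z / σ k + z / σ j < (1 - ρ k) * q.1}) := by
        ext y; simp [S]
      rw [this]
      have hl : ∀ k, Measurable fun q : ℝ × (ι → ℝ) => q.2 k - z / σ k + z / σ j := fun k => by
        have : Measurable fun q : ℝ × (ι → ℝ) => q.2 k := (hmeas k).comp measurable_snd
        exact (this.sub_const _).add_const _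
      have hr : ∀ k, Measurable fun q : ℝ × (ι → ℝ) => (1 - ρ k) * q.1 := fun k => by fun_prop
      refine MeasurableSet.iInter fun k => (measurableSet_le (hl k) (hr k)).inter ?_
      by_cases h : e k < e j
      · simpa [h] using measurableSet_lt (hl k) (hr k)
      · simp [h]
    have hSup : ∀ r, IsUpperSet {u | (u, r) ∈ S} := fun r u u' huu' hu k => by
      have h1 : (1 - ρ k) * u ≤ (1 - ρ k) * u' := mul_le_mul_of_nonneg_left huu'
        (sub_nonneg.2 (IsGaussian.integral_eval_mul_le hσ0 hσ j k))
      exact ⟨(hu k).1.trans h1, fun h => ((hu k).2 h).trans_le h1⟩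
    have hES : E j = V ⁻¹' S := by
      ext y
      refine forall_congr' fun k => ?_
      have h1 : (V y).2 k - z / σ k + z / σ j ≤ (1 - ρ k) * (V y).1 ↔ W k y ≤ W j y := by
        simp only [V, W, sub_div]
        constructor <;> intro h <;> linarith
      have h2 : (V y).2 k - z / σ k + z / σ j < (1 - ρ k) * (V y).1 ↔ W k y < W j y := by
        simp only [V, W, sub_div]
        constructor <;> intro h <;> linarith
      rw [h1, h2]
    have := gaussianReal_prod_inter_Ioc_le
      (ν := γ.map fun y k => y k / σ k - ρ k * (y j / σ j)) hSm hSup (a := z / σ j) hη0 hb1 (by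
        have : z / σ j ≤ |z| / c := by
          have := hcσ j
          calc z / σ j ≤ |z| / σ j := by have := hσ0 j; gcongr; exact le_abs_self z
            _ ≤ |z| / c := by gcongr
        linarith)
    have hIm : MeasurableSet {q : ℝ × (ι → ℝ) | q.1 ∈ Ioc (z / σ j) (z / σ j + η)} :=
      measurable_fst measurableSet_Ioc
    rw [← hlaw, Measure.map_apply hVm hSm, Measure.map_apply hVm (hSm.inter hIm)] at this
    rw [hES]
    exact this
  calc γ {y | (∃ j, z < y j) ∧ ∀ j, y j ≤ z + ε}
      ≤ γ (⋃ j, (E j ∩ {y | y j / σ j ∈ Ioc (z / σ j) (z / σ j + η)})) := measure_mono hcover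
    _ ≤ ∑ j, γ (E j ∩ {y | y j / σ j ∈ Ioc (z / σ j) (z / σ j + η)}) :=
        measure_iUnion_fintype_le _ _
    _ ≤ ∑ j, ENNReal.ofReal (Real.exp (3 / 2) * b * η) * γ (E j) := Finset.sum_le_sum fun j _ => hj j
    _ = ENNReal.ofReal (Real.exp (3 / 2) * b * η) * γ (⋃ j, E j) := by
        rw [← Finset.mul_sum, measure_iUnion hdisj hEm, tsum_fintype]
    _ ≤ ENNReal.ofReal (Real.exp (3 / 2) * b * η) * 1 := by gcongr; exact prob_le_one
    _ = _ := mul_one _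

end vector

/-! ### Gaussian approximation of maxima -/

lemma measurableSet_forall_le {ι Ω : Type*} [Fintype ι] [MeasurableSpace Ω] {X : Ω → ι → ℝ}
    (hX : Measurable X) (z : ℝ) : MeasurableSet {ω | ∀ j, X ω j ≤ z} := by
  have : {ω | ∀ j, X ω j ≤ z} = ⋂ j, {ω | X ω j ≤ z} := by ext; simp
  rw [this]
  exact MeasurableSet.iInter fun j =>
    measurableSet_le ((measurable_pi_apply j).comp hX) measurable_const

/-- A smooth approximation of the indicator function of a lower orthant yields a comparison of
distribution functions of maxima. -/
lemma measureReal_forall_le_le_of_smooth {ι Ω Ω' : Type*} [Fintype ι] [MeasurableSpace Ω]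
    [MeasurableSpace Ω'] {μ : Measure Ω} {μ' : Measure Ω'} [IsProbabilityMeasure μ]
    [IsProbabilityMeasure μ'] {X : Ω → ι → ℝ} {X' : Ω' → ι → ℝ} (hX : Measurable X)
    (hX' : Measurable X') {m : (ι → ℝ) → ℝ} (hm : Measurable m) (hm01 : ∀ x, 0 ≤ m x ∧ m x ≤ 1)
    {z w δ : ℝ} (h1 : ∀ x, (∀ j, x j ≤ z) → m x = 1) (h0 : ∀ x, m x ≠ 0 → ∀ j, x j ≤ z + w)
    (hδ : ∫ ω, m (X ω) ∂μ ≤ ∫ ω, m (X' ω) ∂μ' + δ) :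
    μ.real {ω | ∀ j, X ω j ≤ z} ≤ μ'.real {ω | ∀ j, X' ω j ≤ z + w} + δ := by
  have hb : ∀ x, ‖m x‖ ≤ 1 := fun x => by
    rw [Real.norm_eq_abs, abs_of_nonneg (hm01 x).1]; exact (hm01 x).2
  have hi : Integrable (fun ω => m (X ω)) μ :=
    Integrable.of_bound (hm.comp hX).aestronglyMeasurable 1 (ae_of_all _ fun _ => hb _)
  have hi' : Integrable (fun ω => m (X' ω)) μ' :=
    Integrable.of_bound (hm.comp hX').aestronglyMeasurable 1 (ae_of_all _ fun _ => hb _)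
  have hs := measurableSet_forall_le hX z
  have hs' := measurableSet_forall_le hX' (z + w)
  calc μ.real {ω | ∀ j, X ω j ≤ z}
      = ∫ ω, indicator {ω | ∀ j, X ω j ≤ z} 1 ω ∂μ := (integral_indicator_one hs).symm
    _ ≤ ∫ ω, m (X ω) ∂μ := by
        refine integral_mono ((integrable_const (1 : ℝ)).indicator hs) hi fun ω => ?_
        by_cases h : ω ∈ {ω | ∀ j, X ω j ≤ z}
        · simp only [indicator_of_mem h, Pi.one_apply]
          exact (h1 _ h).ge
        · simp only [indicator_of_notMem h]
          exact (hm01 _).1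
    _ ≤ ∫ ω, m (X' ω) ∂μ' + δ := hδ
    _ ≤ ∫ ω, indicator {ω | ∀ j, X' ω j ≤ z + w} 1 ω ∂μ' + δ := by
        refine add_le_add (integral_mono hi' ((integrable_const (1 : ℝ)).indicator hs')
          fun ω => ?_) le_rfl
        by_cases h : ω ∈ {ω | ∀ j, X' ω j ≤ z + w}
        · simp only [indicator_of_mem h, Pi.one_apply]
          exact (hm01 _).2
        · simp only [indicator_of_notMem h]
          refine le_of_eq ?_
          by_contra h'
          exact h (h0 _ h')
    _ = _ := by rw [integral_indicator_one hs']

/-- Comparison of the distribution functions of the maximum of a normalized sum of bounded vectors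
and of the maximum of the matching Gaussian vector, up to a shift. -/
theorem exists_measureReal_forall_le_comparison : ∃ A : ℝ, 0 ≤ A ∧
    ∀ {ι Ω : Type} [Fintype ι] [Nonempty ι] [MeasurableSpace Ω] {P : Measure Ω}
      [IsProbabilityMeasure P] {X : Ω → ι → ℝ} (_ : Measurable X) {B : ℝ} (_ : 0 ≤ B)
      (_ : ∀ᵐ ω ∂P, ∀ j, |X ω j| ≤ B) (_ : ∀ j, ∫ ω, X ω j ∂P = 0)
      {γ : Measure (ι → ℝ)} [IsGaussian γ] (_ : γ[id] = 0)
      (_ : ∀ j k, ∫ y, y j * y k ∂γ = ∫ ω, X ω j * X ω k ∂P) {n : ℕ} (_ : n ≠ 0)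
      {ψ β : ℝ} (_ : 0 < ψ) (_ : ψ ≤ β) (z : ℝ),
      (Measure.pi fun _ : Fin n => P).real {l | ∀ j, ((√n : ℝ)⁻¹ • ∑ i, X (l i)) j ≤ z}
        ≤ γ.real {y | ∀ j, y j ≤ z + (Real.log (Fintype.card ι) / β + ψ⁻¹)}
          + n * (13 * A * (ψ * β ^ 2) * ((√n)⁻¹ * B) ^ 3
            + 75 * A * (ψ * β ^ 3) * ((√n)⁻¹ ^ 4 * ∫ y, ‖y‖ ^ 4 ∂γ)) ∧
      γ.real {y | ∀ j, y j ≤ z}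
        ≤ (Measure.pi fun _ : Fin n => P).real {l | ∀ j, ((√n : ℝ)⁻¹ • ∑ i, X (l i)) j
            ≤ z + (Real.log (Fintype.card ι) / β + ψ⁻¹)}
          + n * (13 * A * (ψ * β ^ 2) * ((√n)⁻¹ * B) ^ 3
            + 75 * A * (ψ * β ^ 3) * ((√n)⁻¹ ^ 4 * ∫ y, ‖y‖ ^ 4 ∂γ)) := by
  obtain ⟨h, A, hA, hd, hbd, h_one, h_zero, h01⟩ := exists_smooth_step
  refine ⟨A, hA, ?_⟩
  intro ι Ω _ _ _ P _ X hX B hB hXB hX0 γ _ hγ hcov n hn ψ β hψ hψβ z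
  have hβ := hψ.trans_le hψβ
  set z₀ := z + Real.log (Fintype.card ι) / β with hz₀
  set g : ℕ → ℝ → ℝ := fun k u => ψ ^ k * h k (ψ * (u - z₀)) with hg
  have hgd : ∀ k u, HasDerivAt (g k) (g (k + 1) u) u := fun k u => by
    have h1 : HasDerivAt (fun u => ψ * (u - z₀)) ψ u := by
      simpa using ((hasDerivAt_id u).sub_const z₀).const_mul ψ
    have h2 := ((hd k (ψ * (u - z₀))).comp u h1).const_mul (ψ ^ k)
    refine h2.congr_deriv ?_
    simp only [hg]; ring
  have hgb : ∀ k ≤ 4, ∀ u, |g k u| ≤ A * ψ ^ k := fun k hk u => by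
    simp only [hg, abs_mul, abs_pow, abs_of_pos hψ]
    rw [mul_comm]
    exact mul_le_mul_of_nonneg_right (hbd k hk _) (by positivity)
  have hm := measurable_comp_smoothMax (ι := ι) (β := β) hgd
  have hm01 : ∀ x : ι → ℝ, 0 ≤ g 0 (smoothMax β x) ∧ g 0 (smoothMax β x) ≤ 1 := fun x => by
    simpa [hg] using h01 (ψ * (smoothMax β x - z₀))
  have hm1 : ∀ x : ι → ℝ, (∀ j, x j ≤ z) → g 0 (smoothMax β x) = 1 := fun x hx => by
    have := smoothMax_le_of_forall_le hβ hx
    simp only [hg, pow_zero, one_mul]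
    exact h_one _ (mul_nonpos_of_nonneg_of_nonpos hψ.le (by linarith))
  have hm0 : ∀ x : ι → ℝ, g 0 (smoothMax β x) ≠ 0 →
      ∀ j, x j ≤ z + (Real.log (Fintype.card ι) / β + ψ⁻¹) := fun x hx j => by
    have h1 := le_smoothMax hβ x j
    have h2 : ψ * (smoothMax β x - z₀) < 1 := by
      by_contra hc
      exact hx (by simp [hg, h_zero _ (not_lt.1 hc)])
    have h3 : smoothMax β x - z₀ < ψ⁻¹ := by
      rw [← one_div, lt_div_iff₀ hψ]; linarith
    linarith
  have hmain := abs_integral_comp_smoothMax_sum_sub_gaussian_le hgd hA hψ hψβ hgb hX hB hXB hX0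
    hγ hcov hn
  have hS : Measurable fun l : Fin n → Ω => (√n : ℝ)⁻¹ • ∑ i, X (l i) := by
    have : Measurable fun l : Fin n → Ω => ∑ i, X (l i) :=
      Finset.measurable_fun_sum (f := fun i (l : Fin n → Ω) => X (l i)) _
        fun i _ => hX.comp (measurable_pi_apply i)
    exact this.const_smul (√n : ℝ)⁻¹
  rw [abs_le] at hmain
  exact ⟨measureReal_forall_le_le_of_smooth hS measurable_id hm hm01 hm1 hm0
      (by simp only [id_eq]; linarith [hmain.2]),
    measureReal_forall_le_le_of_smooth measurable_id hS hm hm01 hm1 hm0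
      (by simp only [id_eq]; linarith [hmain.1])⟩

lemma IsGaussian.measureReal_forall_le_add_le {ι : Type*} [Fintype ι] {γ : Measure (ι → ℝ)}
    [IsGaussian γ] (hγ : γ[id] = 0) {σ : ι → ℝ} {c B : ℝ}
    (hc : 0 < c) (hB0 : 0 < B) (hcσ : ∀ j, c ≤ σ j) (hσB : ∀ j, σ j ≤ B)
    (hσ : ∀ j, ∫ y, y j * y j ∂γ = σ j ^ 2) (hnn : ∀ᵐ y ∂γ, ∃ j, 0 ≤ y j) (z : ℝ)
    {ε r : ℝ} (hε : 0 ≤ ε) (hr : 0 ≤ r) :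
    γ.real {y | ∀ j, y j ≤ z + ε} ≤ γ.real {y | ∀ j, y j ≤ z}
      + (Fintype.card ι * Real.exp (-(r ^ 2 / (2 * B ^ 2)))
        + Real.exp (3 / 2) * ((r + ε) / c + ε / c + 1) * (ε / c)) := by
  have hsub : γ.real {y | ∀ j, y j ≤ z + ε} ≤ γ.real {y | ∀ j, y j ≤ z}
      + γ.real {y | (∃ j, z < y j) ∧ ∀ j, y j ≤ z + ε} := by
    refine (measureReal_mono fun y hy => ?_).trans (measureReal_union_le _ _)
    by_cases h : ∀ j, y j ≤ z
    · exact Or.inl h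
    · push Not at h
      exact Or.inr ⟨h, hy⟩
  have hn1 : 0 ≤ Fintype.card ι * Real.exp (-(r ^ 2 / (2 * B ^ 2))) := by positivity
  have hn2 : 0 ≤ Real.exp (3 / 2) * ((r + ε) / c + ε / c + 1) * (ε / c) := by positivity
  rcases lt_or_ge (z + ε) 0 with hz | hz
  · have : γ {y | ∀ j, y j ≤ z + ε} = 0 := by
      refine measure_mono_null (fun y hy => ?_) hnn
      rintro ⟨j, hj⟩
      linarith [hy j]
    have h0 : γ.real {y | ∀ j, y j ≤ z + ε} = 0 := by rw [measureReal_def, this]; rfl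
    rw [h0]
    positivity
  rcases le_total r z with hrz | hrz
  · have h1 := IsGaussian.measureReal_exists_gt_le hγ hB0 (fun j => by
      rw [hσ j]; have := hc.le.trans (hcσ j); have := hσB j; gcongr) (hr.trans hrz)
    have h2 : γ.real {y | (∃ j, z < y j) ∧ ∀ j, y j ≤ z + ε} ≤ γ.real {y | ∃ j, z < y j} :=
      measureReal_mono fun y hy => hy.1
    have h3 : Fintype.card ι * Real.exp (-(z ^ 2 / (2 * B ^ 2)))
        ≤ Fintype.card ι * Real.exp (-(r ^ 2 / (2 * B ^ 2))) := by gcongr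
    linarith
  · have h1 := IsGaussian.measure_exists_gt_and_forall_le_le hγ hc hcσ hσ z hε
    have h2 : γ.real {y | (∃ j, z < y j) ∧ ∀ j, y j ≤ z + ε}
        ≤ Real.exp (3 / 2) * (|z| / c + ε / c + 1) * (ε / c) := by
      rw [measureReal_def]
      exact ENNReal.toReal_le_of_le_ofReal (by positivity) h1
    have h3 : |z| ≤ r + ε := abs_le.2 ⟨by linarith, by linarith⟩
    have h4 : Real.exp (3 / 2) * (|z| / c + ε / c + 1) * (ε / c)
        ≤ Real.exp (3 / 2) * ((r + ε) / c + ε / c + 1) * (ε / c) := by gcongr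
    linarith

lemma lindeberg_error_le {A B E q ℓ : ℝ} {n : ℕ} (hA : 0 ≤ A) (hq : 0 < q) (hℓ : 1 ≤ ℓ)
    (hqn : q ^ 8 * n = ℓ ^ 6) (hqℓ : q ^ 3 * ℓ ^ 7 ≤ 1) (hE : E ≤ (3 * ℓ ^ 2) ^ 4
      + 48 * Real.exp (2 * B ^ 2)) :
    n * (13 * A * (q⁻¹ * (q⁻¹ * ℓ ^ 2) ^ 2) * ((√n)⁻¹ * B) ^ 3
      + 75 * A * (q⁻¹ * (q⁻¹ * ℓ ^ 2) ^ 3) * ((√n)⁻¹ ^ 4 * E))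
    ≤ (13 * A * B ^ 3 + 75 * A * (81 + 48 * Real.exp (2 * B ^ 2))) * (q * ℓ) := by
  have hℓ0 : 0 < ℓ := by linarith
  have hn : (n : ℝ) = (ℓ ^ 3 / q ^ 4) ^ 2 := by
    field_simp; linarith
  have hs : √(n : ℝ) = ℓ ^ 3 / q ^ 4 := by rw [hn, Real.sqrt_sq (by positivity)]
  rw [hs, hn]
  have e1 : (ℓ ^ 3 / q ^ 4) ^ 2 * (13 * A * (q⁻¹ * (q⁻¹ * ℓ ^ 2) ^ 2) * ((ℓ ^ 3 / q ^ 4)⁻¹ * B) ^ 3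
      + 75 * A * (q⁻¹ * (q⁻¹ * ℓ ^ 2) ^ 3) * ((ℓ ^ 3 / q ^ 4)⁻¹ ^ 4 * E))
      = 13 * A * B ^ 3 * (q * ℓ) + 75 * A * q ^ 4 * E := by
    field_simp
  rw [e1, add_mul]
  have h8 : 1 ≤ ℓ ^ 8 := one_le_pow₀ hℓ
  have h2 : E ≤ (81 + 48 * Real.exp (2 * B ^ 2)) * ℓ ^ 8 := by
    have : 48 * Real.exp (2 * B ^ 2) * 1 ≤ 48 * Real.exp (2 * B ^ 2) * ℓ ^ 8 := by gcongr
    nlinarith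
  have h3 : 75 * A * q ^ 4 * E ≤ 75 * A * q ^ 4 * ((81 + 48 * Real.exp (2 * B ^ 2)) * ℓ ^ 8) := by
    gcongr
  have h4 : 75 * A * (81 + 48 * Real.exp (2 * B ^ 2)) * (q * ℓ) * (q ^ 3 * ℓ ^ 7)
      ≤ 75 * A * (81 + 48 * Real.exp (2 * B ^ 2)) * (q * ℓ) * 1 := by gcongr
  nlinarith

lemma anticoncentration_error_le {B c D p q ℓ : ℝ} (hB : 0 < B) (hc : 0 < c) (hD : 0 ≤ D)
    (hq : 0 < q) (hq1 : q ≤ 1) (hℓ : 1 ≤ ℓ) (hp : 0 < p) (hpℓ : Real.log p ≤ 3 * ℓ ^ 2)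
    (hexp : Real.exp (-ℓ ^ 2) ≤ q) :
    p * Real.exp (-((3 * B * ℓ) ^ 2 / (2 * B ^ 2)))
      + Real.exp (3 / 2) * ((3 * B * ℓ + D * q) / c + D * q / c + 1) * (D * q / c)
    ≤ (1 + Real.exp (3 / 2) * ((3 * B + D) / c + D / c + 1) * (D / c)) * (q * ℓ) := by
  have h1 : p * Real.exp (-((3 * B * ℓ) ^ 2 / (2 * B ^ 2))) ≤ q * 1 := by
    rw [mul_one]
    refine le_trans ?_ hexp
    rw [← Real.exp_log hp, ← Real.exp_add, Real.exp_le_exp]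
    have : (3 * B * ℓ) ^ 2 / (2 * B ^ 2) = 9 / 2 * ℓ ^ 2 := by field_simp; norm_num
    rw [this]
    nlinarith [sq_nonneg ℓ]
  have h1' : q * 1 ≤ q * ℓ := by gcongr
  have h2 : Real.exp (3 / 2) * ((3 * B * ℓ + D * q) / c + D * q / c + 1) * (D * q / c)
      ≤ Real.exp (3 / 2) * ((3 * B * ℓ + D * ℓ) / c + D * ℓ / c + ℓ) * (D * q / c) := by
    have : q ≤ ℓ := hq1.trans hℓ
    gcongr
  have h3 : Real.exp (3 / 2) * ((3 * B * ℓ + D * ℓ) / c + D * ℓ / c + ℓ) * (D * q / c)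
      = Real.exp (3 / 2) * ((3 * B + D) / c + D / c + 1) * (D / c) * (q * ℓ) := by
    field_simp
  rw [add_mul, one_mul]
  linarith

/-- Gaussian approximation of the maximum of a normalized sum of bounded vectors, with error
`q * ℓ`, where `q` is essentially `((log n) ^ 3 / n) ^ (1 / 8)` and `ℓ` is `√(log n)`. -/
theorem exists_measureReal_forall_le_approx {B c D : ℝ} (hB : 0 < B) (hc : 0 < c) (hD : 0 ≤ D) :
    ∃ C : ℝ, 0 ≤ C ∧
    ∀ {ι Ω : Type} [Fintype ι] [Nonempty ι] [MeasurableSpace Ω] {P : Measure Ω}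
      [IsProbabilityMeasure P] {X : Ω → ι → ℝ} (_ : Measurable X)
      (_ : ∀ᵐ ω ∂P, ∀ j, |X ω j| ≤ B) (_ : ∀ j, ∫ ω, X ω j ∂P = 0)
      {γ : Measure (ι → ℝ)} [IsGaussian γ] (_ : γ[id] = 0)
      (_ : ∀ j k, ∫ y, y j * y k ∂γ = ∫ ω, X ω j * X ω k ∂P)
      (_ : ∀ j, c ^ 2 ≤ ∫ y, y j * y j ∂γ) (_ : ∀ᵐ y ∂γ, ∃ j, 0 ≤ y j)
      {n : ℕ} (_ : n ≠ 0) {q ℓ : ℝ} (_ : 0 < q) (_ : q ≤ 1) (_ : 1 ≤ ℓ) (_ : q ^ 8 * n = ℓ ^ 6)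
      (_ : q ^ 3 * ℓ ^ 7 ≤ 1) (_ : Real.exp (-ℓ ^ 2) ≤ q)
      (_ : Real.log (Fintype.card ι) ≤ 3 * ℓ ^ 2) (z : ℝ),
      (Measure.pi fun _ : Fin n => P).real {l | ∀ j, ((√n : ℝ)⁻¹ • ∑ i, X (l i)) j ≤ z}
        ≤ γ.real {y | ∀ j, y j ≤ z - D * q} + C * (q * ℓ) ∧
      γ.real {y | ∀ j, y j ≤ z + D * q}
        ≤ (Measure.pi fun _ : Fin n => P).real {l | ∀ j, ((√n : ℝ)⁻¹ • ∑ i, X (l i)) j ≤ z}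
          + C * (q * ℓ) := by
  obtain ⟨A, hA, hmain⟩ := exists_measureReal_forall_le_comparison
  refine ⟨(13 * A * B ^ 3 + 75 * A * (81 + 48 * Real.exp (2 * B ^ 2)))
    + (1 + Real.exp (3 / 2) * ((3 * B + (4 + D)) / c + (4 + D) / c + 1) * ((4 + D) / c)),
    by positivity, ?_⟩
  intro ι Ω _ _ _ P _ X hX hXB hX0 γ _ hγ hcov hcσ hnn n hn q ℓ hq hq1 hℓ hqn hqℓ hexp hcard z
  have hℓ0 : 0 < ℓ := by linarith
  have hlog0 : 0 ≤ Real.log (Fintype.card ι) := Real.log_natCast_nonneg _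
  have hvB : ∀ j, ∫ y, y j * y j ∂γ ≤ B ^ 2 := fun j => by
    rw [hcov j j]
    have hXj : Measurable fun ω => X ω j := (measurable_pi_apply j).comp hX
    have hb : ∀ᵐ ω ∂P, X ω j * X ω j ≤ B ^ 2 := by
      filter_upwards [hXB] with ω hω
      rw [← sq]
      exact sq_le_sq' (abs_le.1 (hω j)).1 (abs_le.1 (hω j)).2
    have hi : Integrable (fun ω => X ω j * X ω j) P :=
      Integrable.of_bound (hXj.mul hXj).aestronglyMeasurable (B ^ 2) <| by
        filter_upwards [hb] with ω hω
        rwa [Real.norm_of_nonneg (mul_self_nonneg _)]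
    calc ∫ ω, X ω j * X ω j ∂P ≤ ∫ _, B ^ 2 ∂P := integral_mono_ae hi (integrable_const _) hb
      _ = B ^ 2 := by simp
  have hE : ∫ y, ‖y‖ ^ 4 ∂γ ≤ (3 * ℓ ^ 2) ^ 4 + 48 * Real.exp (2 * B ^ 2) := by
    refine (IsGaussian.integral_norm_pow_four_le hγ hvB).trans ?_
    gcongr
  have herr := lindeberg_error_le hA hq hℓ hqn hqℓ hE
  set σ : ι → ℝ := fun j => √(∫ y, y j * y j ∂γ) with hσdef
  have hσ : ∀ j, ∫ y, y j * y j ∂γ = σ j ^ 2 := fun j =>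
    (Real.sq_sqrt ((sq_nonneg c).trans (hcσ j))).symm
  have hcσ' : ∀ j, c ≤ σ j := fun j => Real.le_sqrt_of_sq_le (hcσ j)
  have hσB : ∀ j, σ j ≤ B := fun j => Real.sqrt_le_left hB.le |>.2 (hvB j)
  have hanti := fun z' => IsGaussian.measureReal_forall_le_add_le hγ hc hB hcσ' hσB hσ hnn z'
    (ε := (4 + D) * q) (r := 3 * B * ℓ) (by positivity) (by positivity)
  have hae := anticoncentration_error_le (D := 4 + D) (p := Fintype.card ι) hB hc (by positivity)
    hq hq1 hℓ (by exact_mod_cast Fintype.card_pos) hcard hexp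
  have hψβ : q⁻¹ ≤ q⁻¹ * ℓ ^ 2 := le_mul_of_one_le_right (by positivity) (one_le_pow₀ hℓ)
  have hw : Real.log (Fintype.card ι) / (q⁻¹ * ℓ ^ 2) + q⁻¹⁻¹ ≤ 4 * q := by
    have : Real.log (Fintype.card ι) / (q⁻¹ * ℓ ^ 2) ≤ 3 * q := by
      rw [div_le_iff₀ (by positivity)]
      calc _ ≤ _ := hcard
        _ = _ := by field_simp
    rw [inv_inv]
    linarith
  set w := Real.log (Fintype.card ι) / (q⁻¹ * ℓ ^ 2) + q⁻¹⁻¹ with hwdef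
  have hcomp := fun z' => hmain hX hB.le hXB hX0 hγ hcov hn (inv_pos.2 hq) hψβ z'
  rw [add_mul]
  constructor
  · have h1 := (hcomp z).1
    have h2 := hanti (z - D * q)
    have h3 : γ.real {y | ∀ j, y j ≤ z + w}
        ≤ γ.real {y | ∀ j, y j ≤ z - D * q + (4 + D) * q} :=
      measureReal_mono fun y hy j => (hy j).trans (by linarith)
    linarith
  · have h1 := (hcomp (z - w)).2
    have h2 := hanti (z - w)
    rw [← hwdef, sub_add_cancel] at h1
    have h3 : γ.real {y | ∀ j, y j ≤ z + D * q}
        ≤ γ.real {y | ∀ j, y j ≤ z - w + (4 + D) * q} :=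
      measureReal_mono fun y hy j => (hy j).trans (by linarith)
    linarith

/-! ### Landscapes -/

lemma measurable_eval_const (t : ℝ) : Measurable fun f : C(ℝ, ℝ) => f t :=
  (continuous_eval_const t).measurable

lemma isClosed_setOf_isLandscapeType (T : ℝ) : IsClosed {f : C(ℝ, ℝ) | IsLandscapeType T f} := by
  have he : ∀ t : ℝ, Continuous fun f : C(ℝ, ℝ) => f t := continuous_eval_const
  simp only [IsLandscapeType, lipschitzWith_iff_dist_le_mul, ofPred_and, ofPred_forall]
  refine (isClosed_iInter fun s => isClosed_iInter fun t => ?_).inter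
    ((isClosed_iInter fun t => ?_).inter (isClosed_iInter fun t => isClosed_iInter fun _ => ?_))
  · exact isClosed_le ((he s).dist (he t)) continuous_const
  · exact (isClosed_le continuous_const (he t)).inter (isClosed_le (he t) continuous_const)
  · exact isClosed_eq (he t) continuous_const

lemma IsLandscapeType.abs_sub_le {T : ℝ} {f : ℝ → ℝ} (hf : IsLandscapeType T f) (s t : ℝ) :
    |f s - f t| ≤ |s - t| := by
  simpa [Real.dist_eq] using hf.1.dist_le_mul s t

section landscape

variable {T : ℝ} {P : Measure C(ℝ, ℝ)} [IsProbabilityMeasure P]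

lemma ae_isLandscapeType (hP : P {f | IsLandscapeType T f} = 1) :
    ∀ᵐ f : C(ℝ, ℝ) ∂P, IsLandscapeType T f :=
  (mem_ae_iff_prob_eq_one (isClosed_setOf_isLandscapeType T).measurableSet).2 hP

lemma integrable_eval_const (h : ∀ᵐ f : C(ℝ, ℝ) ∂P, IsLandscapeType T f) (t : ℝ) :
    Integrable (fun f : C(ℝ, ℝ) => f t) P :=
  Integrable.of_bound (measurable_eval_const t).aestronglyMeasurable (T / 2) <| by
    filter_upwards [h] with f hf
    rw [Real.norm_of_nonneg (hf.2.1 t).1]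
    exact (hf.2.1 t).2

lemma integrable_eval_const_mul (h : ∀ᵐ f : C(ℝ, ℝ) ∂P, IsLandscapeType T f) (s t : ℝ) :
    Integrable (fun f : C(ℝ, ℝ) => f s * f t) P :=
  Integrable.of_bound ((measurable_eval_const s).mul
    (measurable_eval_const t)).aestronglyMeasurable (T / 2 * (T / 2)) <| by
    filter_upwards [h] with f hf
    have hs := hf.2.1 s
    have ht := hf.2.1 t
    rw [Real.norm_of_nonneg (mul_nonneg hs.1 ht.1)]
    exact mul_le_mul hs.2 ht.2 ht.1 (hs.1.trans hs.2)

lemma lmean_mem_Icc (h : ∀ᵐ f : C(ℝ, ℝ) ∂P, IsLandscapeType T f) (t : ℝ) :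
    lmean P t ∈ Icc 0 (T / 2) := by
  constructor
  · exact integral_nonneg_of_ae (by filter_upwards [h] with f hf using (hf.2.1 t).1)
  · calc lmean P t ≤ ∫ _, T / 2 ∂P := integral_mono_ae (integrable_eval_const h t)
          (integrable_const _) (by filter_upwards [h] with f hf using (hf.2.1 t).2)
      _ = T / 2 := by simp

lemma abs_lmean_sub_le (h : ∀ᵐ f : C(ℝ, ℝ) ∂P, IsLandscapeType T f) (s t : ℝ) :
    |lmean P s - lmean P t| ≤ |s - t| := by
  have h1 : lmean P s - lmean P t = ∫ f, (f s - f t) ∂P :=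
    (integral_sub (integrable_eval_const h s) (integrable_eval_const h t)).symm
  rw [h1, ← Real.norm_eq_abs]
  refine (norm_integral_le_of_norm_le_const (C := |s - t|) ?_).trans (by simp)
  filter_upwards [h] with f hf using hf.abs_sub_le s t

lemma ae_abs_sub_lmean_le (h : ∀ᵐ f : C(ℝ, ℝ) ∂P, IsLandscapeType T f) :
    ∀ᵐ f : C(ℝ, ℝ) ∂P, ∀ t, |f t - lmean P t| ≤ T / 2 := by
  filter_upwards [h] with f hf t
  have h1 := lmean_mem_Icc h t
  have h2 := hf.2.1 t
  exact abs_le.2 ⟨by linarith [h1.2, h2.1], by linarith [h1.1, h2.2]⟩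

lemma integral_eval_sub_lmean (h : ∀ᵐ f : C(ℝ, ℝ) ∂P, IsLandscapeType T f) (t : ℝ) :
    ∫ f, (f t - lmean P t) ∂P = 0 := by
  rw [integral_sub (integrable_eval_const h t) (integrable_const _)]
  simp [lmean]

lemma integrable_sub_lmean_mul (h : ∀ᵐ f : C(ℝ, ℝ) ∂P, IsLandscapeType T f) (s t : ℝ) :
    Integrable (fun f : C(ℝ, ℝ) => (f s - lmean P s) * (f t - lmean P t)) P := by
  have h1 := ((integrable_eval_const_mul h s t).sub ((integrable_eval_const h s).mul_const
    (lmean P t))).sub (((integrable_eval_const h t).const_mul (lmean P s)).sub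
      (integrable_const (lmean P s * lmean P t)))
  refine h1.congr (ae_of_all _ fun f => ?_)
  simp only [Pi.sub_apply]; ring

lemma integral_sub_lmean_mul (h : ∀ᵐ f : C(ℝ, ℝ) ∂P, IsLandscapeType T f) (s t : ℝ) :
    ∫ f, (f s - lmean P s) * (f t - lmean P t) ∂P = lcov P s t := by
  have e : ∀ f : C(ℝ, ℝ), (f s - lmean P s) * (f t - lmean P t)
      = (f s * f t - f s * lmean P t) - lmean P s * (f t - lmean P t) := fun f => by ring
  have i1 := integrable_eval_const_mul h s t
  have i2 := (integrable_eval_const h s).mul_const (lmean P t)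
  have i3 : Integrable (fun f : C(ℝ, ℝ) => f t - lmean P t) P :=
    (integrable_eval_const h t).sub (integrable_const _)
  have i4 : Integrable (fun f : C(ℝ, ℝ) => f s * f t - f s * lmean P t) P := i1.sub i2
  simp_rw [e]
  rw [integral_sub i4 (i3.const_mul _), integral_sub i1 i2, integral_const_mul,
    integral_mul_const, integral_eval_sub_lmean h, mul_zero, sub_zero]
  rfl

lemma integral_sum_mul_sub_lmean_sq (h : ∀ᵐ f : C(ℝ, ℝ) ∂P, IsLandscapeType T f) {m : ℕ} (s a : Fin m → ℝ) :
    ∫ f, (∑ i, a i * (f (s i) - lmean P (s i))) ^ 2 ∂P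
      = ∑ i, ∑ j, a i * a j * lcov P (s i) (s j) := by
  have e : ∀ f : C(ℝ, ℝ), (∑ i, a i * (f (s i) - lmean P (s i))) ^ 2
      = ∑ i, ∑ j, a i * a j * ((f (s i) - lmean P (s i)) * (f (s j) - lmean P (s j))) :=
    fun f => by
      rw [sq, Finset.sum_mul_sum]
      exact Finset.sum_congr rfl fun i _ => Finset.sum_congr rfl fun j _ => by ring
  have hi := fun i j => (integrable_sub_lmean_mul h (s i) (s j)).const_mul (a i * a j)
  simp_rw [e]
  rw [integral_finsetSum _ fun i _ => integrable_finsetSum _ fun j _ => hi i j]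
  refine Finset.sum_congr rfl fun i _ => ?_
  rw [integral_finsetSum _ fun j _ => hi i j]
  exact Finset.sum_congr rfl fun j _ => by rw [integral_const_mul, integral_sub_lmean_mul h]

lemma sum_mul_lcov_nonneg (h : ∀ᵐ f : C(ℝ, ℝ) ∂P, IsLandscapeType T f) {m : ℕ} (s a : Fin m → ℝ) :
    0 ≤ ∑ i, ∑ j, a i * a j * lcov P (s i) (s j) := by
  rw [← integral_sum_mul_sub_lmean_sq h]
  exact integral_nonneg fun f => sq_nonneg _

lemma lcov_increment_le (h : ∀ᵐ f : C(ℝ, ℝ) ∂P, IsLandscapeType T f) (s t : ℝ) :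
    ∑ i, ∑ j, (![1, -1] : Fin 2 → ℝ) i * (![1, -1] : Fin 2 → ℝ) j * lcov P (![s, t] i) (![s, t] j)
      ≤ 4 * (s - t) ^ 2 := by
  rw [← integral_sum_mul_sub_lmean_sq h]
  have hb : ∀ᵐ f : C(ℝ, ℝ) ∂P, ‖(∑ i, (![1, -1] : Fin 2 → ℝ) i
      * (f (![s, t] i) - lmean P (![s, t] i))) ^ 2‖ ≤ 4 * (s - t) ^ 2 := by
    filter_upwards [h] with f hf
    have h1 := abs_le.1 (hf.abs_sub_le s t)
    have h2 := abs_le.1 (abs_lmean_sub_le h s t)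
    have h3 : 4 * (s - t) ^ 2 = (2 * |s - t|) ^ 2 := by rw [mul_pow, sq_abs]; norm_num
    rw [Real.norm_of_nonneg (sq_nonneg _), h3]
    simp only [Fin.sum_univ_two, Matrix.cons_val_zero, Matrix.cons_val_one]
    exact sq_le_sq' (by linarith [h1.1, h2.2]) (by linarith [h1.2, h2.1])
  refine (Real.le_norm_self _).trans ((norm_integral_le_of_norm_le_const hb).trans (by simp))

end landscape

/-! ### The limiting Gaussian process -/

lemma integral_sq_gaussianReal (v : NNReal) : ∫ x, x ^ 2 ∂gaussianReal 0 v = v := by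
  have h := variance_eq_sub (memLp_id_gaussianReal (μ := 0) (v := v) 2)
  rw [variance_id_gaussianReal] at h
  simpa using h.symm

/-- The process `G` restricted to `I` is centered Gaussian with covariance function `lcov P`. -/
def IsBridgeOn {Ω : Type*} [MeasurableSpace Ω] (P : Measure C(ℝ, ℝ)) (I : Set ℝ) (Q : Measure Ω)
    (G : Ω → ℝ → ℝ) : Prop :=
  ∀ (m : ℕ) (s : Fin m → ℝ), (∀ i, s i ∈ I) → ∀ a : Fin m → ℝ,
    Measure.map (fun ω => ∑ i, a i * G ω (s i)) Q =
      gaussianReal 0 (∑ i, ∑ j, a i * a j * lcov P (s i) (s j)).toNNReal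

section bridge

variable {T : ℝ} {P : Measure C(ℝ, ℝ)} {Ω : Type*} [MeasurableSpace Ω]
  {Q : Measure Ω} {G : Ω → ℝ → ℝ} {I : Set ℝ}

lemma IsBridgeOn.aemeasurable_sum (hG : IsBridgeOn P I Q G) {m : ℕ} {s : Fin m → ℝ}
    (hs : ∀ i, s i ∈ I) (a : Fin m → ℝ) : AEMeasurable (fun ω => ∑ i, a i * G ω (s i)) Q := by
  by_contra h
  have h1 := hG m s hs a
  rw [Measure.map_of_not_aemeasurable h] at h1
  exact IsProbabilityMeasure.ne_zero _ h1.symm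

lemma IsBridgeOn.aemeasurable (hG : IsBridgeOn P I Q G) {t : ℝ} (ht : t ∈ I) :
    AEMeasurable (fun ω => G ω t) Q := by
  simpa using hG.aemeasurable_sum (m := 1) (s := fun _ => t) (fun _ => ht) 1

lemma IsBridgeOn.memLp_sum (hG : IsBridgeOn P I Q G) {m : ℕ} {s : Fin m → ℝ}
    (hs : ∀ i, s i ∈ I) (a : Fin m → ℝ) : MemLp (fun ω => ∑ i, a i * G ω (s i)) 2 Q := by
  have h := memLp_id_gaussianReal (μ := 0)
    (v := (∑ i, ∑ j, a i * a j * lcov P (s i) (s j)).toNNReal) 2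
  rw [← hG m s hs a] at h
  exact (memLp_map_measure_iff h.aestronglyMeasurable (hG.aemeasurable_sum hs a)).1 h

lemma IsBridgeOn.integral_sum_sq [IsProbabilityMeasure P]
    (h : ∀ᵐ f : C(ℝ, ℝ) ∂P, IsLandscapeType T f)
    (hG : IsBridgeOn P I Q G) {m : ℕ} {s : Fin m → ℝ} (hs : ∀ i, s i ∈ I) (a : Fin m → ℝ) :
    ∫ ω, (∑ i, a i * G ω (s i)) ^ 2 ∂Q = ∑ i, ∑ j, a i * a j * lcov P (s i) (s j) := by
  have h1 := integral_sq_gaussianReal (∑ i, ∑ j, a i * a j * lcov P (s i) (s j)).toNNReal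
  rw [← hG m s hs a, integral_map (hG.aemeasurable_sum hs a) (by fun_prop),
    Real.coe_toNNReal _ (sum_mul_lcov_nonneg h s a)] at h1
  exact h1

lemma IsBridgeOn.integral_eq_zero (hG : IsBridgeOn P I Q G) {t : ℝ} (ht : t ∈ I) :
    ∫ ω, G ω t ∂Q = 0 := by
  have h1 := hG 1 (fun _ => t) (fun _ => ht) 1
  have h2 := integral_id_gaussianReal (μ := 0)
    (v := (∑ i : Fin 1, ∑ j : Fin 1, (1 : Fin 1 → ℝ) i * (1 : Fin 1 → ℝ) j * lcov P t t).toNNReal)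
  rw [← h1, integral_map (hG.aemeasurable_sum (fun _ => ht) 1) (by fun_prop)] at h2
  simpa using h2

lemma lcov_comm (P : Measure C(ℝ, ℝ)) (s t : ℝ) : lcov P s t = lcov P t s := by
  simp only [lcov, mul_comm]

lemma IsBridgeOn.integral_mul [IsProbabilityMeasure P]
    (h : ∀ᵐ f : C(ℝ, ℝ) ∂P, IsLandscapeType T f)
    (hG : IsBridgeOn P I Q G) {s t : ℝ} (hs : s ∈ I) (ht : t ∈ I) :
    ∫ ω, G ω s * G ω t ∂Q = lcov P s t := by
  have hst : ∀ i, ![s, t] i ∈ I := by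
    intro i; fin_cases i
    · exact hs
    · exact ht
  have h1 := hG.integral_sum_sq h hst ![1, 1]
  have h2 := hG.integral_sum_sq h hst ![1, -1]
  have i1 := (hG.memLp_sum hst ![1, 1]).integrable_sq
  have i2 := (hG.memLp_sum hst ![1, -1]).integrable_sq
  have e : ∀ ω, G ω s * G ω t = ((∑ i, (![1, 1] : Fin 2 → ℝ) i * G ω (![s, t] i)) ^ 2
      - (∑ i, (![1, -1] : Fin 2 → ℝ) i * G ω (![s, t] i)) ^ 2) / 4 := fun ω => by
    simp only [Fin.sum_univ_two, Matrix.cons_val_zero, Matrix.cons_val_one]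
    ring
  simp_rw [e]
  rw [integral_div, integral_sub i1 i2, h1, h2]
  simp only [Fin.sum_univ_two, Matrix.cons_val_zero, Matrix.cons_val_one, lcov_comm P t s]
  ring

lemma IsBridgeOn.measure_le_abs_sub_le [IsProbabilityMeasure P]
    (h : ∀ᵐ f : C(ℝ, ℝ) ∂P, IsLandscapeType T f)
    (hG : IsBridgeOn P I Q G) {s t : ℝ} (hs : s ∈ I) (ht : t ∈ I) {ε : ℝ} (hε : 0 < ε) :
    Q {ω | ε ≤ |G ω s - G ω t|} ≤ ENNReal.ofReal (4 * (s - t) ^ 2 / ε ^ 2) := by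
  have hst : ∀ i, ![s, t] i ∈ I := by
    intro i; fin_cases i
    · exact hs
    · exact ht
  have h1 := hG 2 _ hst ![1, -1]
  set v := (∑ i, ∑ j, (![1, -1] : Fin 2 → ℝ) i * (![1, -1] : Fin 2 → ℝ) j
    * lcov P (![s, t] i) (![s, t] j)).toNNReal with hv
  have hv4 : (v : ℝ) ≤ 4 * (s - t) ^ 2 :=
    (Real.coe_toNNReal' _).trans_le (max_le (lcov_increment_le h s t) (by positivity))
  have h2 := meas_ge_le_variance_div_sq (memLp_id_gaussianReal (μ := 0) (v := v) 2) hε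
  have hm : MeasurableSet {x : ℝ | ε ≤ |x|} := measurableSet_le measurable_const measurable_norm
  calc Q {ω | ε ≤ |G ω s - G ω t|} = gaussianReal 0 v {x | ε ≤ |x|} := by
        rw [← h1, Measure.map_apply_of_aemeasurable (hG.aemeasurable_sum hst _) hm]
        simp [Fin.sum_univ_two, sub_eq_add_neg]
    _ ≤ ENNReal.ofReal (v / ε ^ 2) := by
        simpa [variance_id_gaussianReal, integral_id_gaussianReal] using h2
    _ ≤ _ := by gcongr

end bridge

/-! ### Finite-dimensional marginals, with both signs -/

/-- The values of `g` at the points `s i`, with both signs. -/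
def signedValues {m : ℕ} (s : Fin m → ℝ) (g : ℝ → ℝ) : Fin m × Bool → ℝ :=
  fun p => (if p.2 then 1 else -1) * g (s p.1)

lemma forall_signedValues_le_iff {m : ℕ} {s : Fin m → ℝ} {g : ℝ → ℝ} {z : ℝ} :
    (∀ p, signedValues s g p ≤ z) ↔ ∀ i, |g (s i)| ≤ z := by
  simp only [signedValues, Prod.forall, Bool.forall_bool, abs_le']
  refine forall_congr' fun i => ?_
  simp [and_comm]

section marginal

variable {T : ℝ} {P : Measure C(ℝ, ℝ)} {Ω : Type*} [MeasurableSpace Ω]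
  {Q : Measure Ω} {G : Ω → ℝ → ℝ} {I : Set ℝ} {m : ℕ} {s : Fin m → ℝ}

lemma IsBridgeOn.aemeasurable_signedValues (hG : IsBridgeOn P I Q G) (hs : ∀ i, s i ∈ I) :
    AEMeasurable (fun ω => signedValues s (G ω)) Q :=
  aemeasurable_pi_iff.2 fun p => (hG.aemeasurable (hs p.1)).const_mul _

lemma IsBridgeOn.isGaussian_map_signedValues (hG : IsBridgeOn P I Q G) (hs : ∀ i, s i ∈ I) :
    IsGaussian (Q.map fun ω => signedValues s (G ω)) := by
  refine isGaussian_of_map_eq_gaussianReal fun L => ?_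
  rw [AEMeasurable.map_map_of_aemeasurable (by fun_prop) (hG.aemeasurable_signedValues hs)]
  refine ⟨0, _, Eq.trans ?_
    (hG m s hs fun i => L (Pi.single (i, true) 1) - L (Pi.single (i, false) 1))⟩
  congr 1
  ext ω
  have h1 : ∀ y : Fin m × Bool → ℝ, L y = ∑ p, y p * L (Pi.single p 1) := fun y => by
    conv_lhs => rw [pi_eq_sum_univ' y]
    simp [map_sum]
  rw [Function.comp_apply, h1, Fintype.sum_prod_type]
  refine Finset.sum_congr rfl fun i _ => ?_
  simp [signedValues]
  ring

lemma IsBridgeOn.integral_id_map_signedValues (hG : IsBridgeOn P I Q G) (hs : ∀ i, s i ∈ I) :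
    (Q.map fun ω => signedValues s (G ω))[id] = 0 := by
  have := hG.isGaussian_map_signedValues hs
  have hm := hG.aemeasurable_signedValues hs
  ext p
  have hi : Integrable id (Q.map fun ω => signedValues s (G ω)) := IsGaussian.integrable_id
  have h1 := ((ContinuousLinearMap.proj (R := ℝ) (φ := fun _ : Fin m × Bool => ℝ) p
    ).integral_comp_comm hi).symm
  simp only [ContinuousLinearMap.proj_apply, id_eq] at h1
  have hp : Measurable fun y : Fin m × Bool → ℝ => y p := measurable_pi_apply p
  rw [integral_map hm hp.aestronglyMeasurable] at h1
  simp only [signedValues, integral_const_mul, hG.integral_eq_zero (hs p.1), mul_zero] at h1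
  exact h1

lemma IsBridgeOn.integral_mul_map_signedValues [IsProbabilityMeasure P]
    (h : ∀ᵐ f : C(ℝ, ℝ) ∂P, IsLandscapeType T f)
    (hG : IsBridgeOn P I Q G) (hs : ∀ i, s i ∈ I) (j k : Fin m × Bool) :
    ∫ y, y j * y k ∂(Q.map fun ω => signedValues s (G ω))
      = (if j.2 then 1 else -1) * (if k.2 then 1 else -1) * lcov P (s j.1) (s k.1) := by
  have hj : Measurable fun y : Fin m × Bool → ℝ => y j := measurable_pi_apply j
  have hk : Measurable fun y : Fin m × Bool → ℝ => y k := measurable_pi_apply k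
  have hjk : Measurable fun y : Fin m × Bool → ℝ => y j * y k := hj.mul hk
  rw [integral_map (hG.aemeasurable_signedValues hs) hjk.aestronglyMeasurable,
    ← hG.integral_mul h (hs j.1) (hs k.1), ← integral_const_mul]
  congr 1
  ext ω
  simp only [signedValues]
  ring

lemma integral_signedValues_sub_lmean_mul [IsProbabilityMeasure P]
    (h : ∀ᵐ f : C(ℝ, ℝ) ∂P, IsLandscapeType T f)
    (s : Fin m → ℝ) (j k : Fin m × Bool) :
    ∫ f : C(ℝ, ℝ), signedValues s (fun t => f t - lmean P t) j
        * signedValues s (fun t => f t - lmean P t) k ∂P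
      = (if j.2 then 1 else -1) * (if k.2 then 1 else -1) * lcov P (s j.1) (s k.1) := by
  rw [← integral_sub_lmean_mul h, ← integral_const_mul]
  congr 1
  ext f
  simp only [signedValues]
  ring

lemma measurable_signedValues_sub_lmean (s : Fin m → ℝ) :
    Measurable fun f : C(ℝ, ℝ) => signedValues s fun t => f t - lmean P t :=
  measurable_pi_iff.2 fun p => ((measurable_eval_const (s p.1)).sub_const _).const_mul _

lemma ae_abs_signedValues_sub_lmean_le [IsProbabilityMeasure P]
    (h : ∀ᵐ f : C(ℝ, ℝ) ∂P, IsLandscapeType T f)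
    (s : Fin m → ℝ) :
    ∀ᵐ f : C(ℝ, ℝ) ∂P, ∀ p, |signedValues s (fun t => f t - lmean P t) p| ≤ T / 2 := by
  filter_upwards [ae_abs_sub_lmean_le h] with f hf p
  have h1 := hf (s p.1)
  rcases p with ⟨i, _ | _⟩ <;> simpa [signedValues, abs_sub_comm] using h1

lemma integral_signedValues_sub_lmean [IsProbabilityMeasure P]
    (h : ∀ᵐ f : C(ℝ, ℝ) ∂P, IsLandscapeType T f)
    (s : Fin m → ℝ) (p : Fin m × Bool) :
    ∫ f : C(ℝ, ℝ), signedValues s (fun t => f t - lmean P t) p ∂P = 0 := by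
  simp only [signedValues, integral_const_mul, integral_eval_sub_lmean h, mul_zero]

lemma smul_sum_signedValues_sub_lmean {n : ℕ} (hn : n ≠ 0) (s : Fin m → ℝ)
    (l : Fin n → C(ℝ, ℝ)) :
    (√n : ℝ)⁻¹ • ∑ i, signedValues s (fun t => l i t - lmean P t)
      = signedValues s fun t => √n * (empMean n l t - lmean P t) := by
  ext p
  have h0 : (0 : ℝ) < √n := Real.sqrt_pos.2 (by positivity)
  have h1 : (n : ℝ) = √n * √n := (Real.mul_self_sqrt (by positivity)).symm
  simp only [signedValues, empMean, Pi.smul_apply, Finset.sum_apply, smul_eq_mul,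
    ← Finset.mul_sum, Finset.sum_sub_distrib, Finset.sum_const, Finset.card_univ,
    Fintype.card_fin, nsmul_eq_mul]
  rw [mul_left_comm]
  congr 1
  have h2 : √(n : ℝ) * ((∑ i, l i (s p.1)) / n - lmean P (s p.1))
      = √n / n * (∑ i, l i (s p.1) - n * lmean P (s p.1)) := by
    field_simp
  rw [h2, Real.sqrt_div_self]

end marginal

/-! ### Dyadic discretization -/

/-- The `i`-th dyadic point of level `k` of the interval `[a, b]`. -/
def dyadicPoint (a b : ℝ) (k i : ℕ) : ℝ := a + i / 2 ^ k * (b - a)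

lemma dyadicPoint_mem_Icc {a b : ℝ} (hab : a ≤ b) {k i : ℕ} (hi : i ≤ 2 ^ k) :
    dyadicPoint a b k i ∈ Icc a b := by
  have h0 : 0 ≤ b - a := sub_nonneg.2 hab
  have h1 : (i : ℝ) / 2 ^ k ≤ 1 := (div_le_one (by positivity)).2 (by exact_mod_cast hi)
  have h2 : (i : ℝ) / 2 ^ k * (b - a) ≤ 1 * (b - a) := by gcongr
  have h3 : 0 ≤ (i : ℝ) / 2 ^ k * (b - a) := by positivity
  simp only [dyadicPoint, mem_Icc]
  constructor <;> linarith

lemma dyadicPoint_succ (a b : ℝ) (k i : ℕ) :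
    dyadicPoint a b (k + 1) (2 * i) = dyadicPoint a b k i := by
  simp only [dyadicPoint, Nat.cast_mul, Nat.cast_ofNat, pow_succ]
  field_simp

lemma dyadicPoint_succ_sub (a b : ℝ) (k i : ℕ) :
    dyadicPoint a b (k + 1) (2 * i + 1) - dyadicPoint a b k i = (b - a) / 2 ^ (k + 1) := by
  simp only [dyadicPoint, Nat.cast_mul, Nat.cast_ofNat, pow_succ, Nat.cast_add, Nat.cast_one]
  field_simp
  ring

lemma exists_dyadicPoint_abs_sub_le {a b t : ℝ} (hab : a < b) (ht : t ∈ Icc a b) (k : ℕ) :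
    ∃ i ≤ 2 ^ k, |t - dyadicPoint a b k i| ≤ (b - a) / 2 ^ k := by
  have h0 : 0 < b - a := sub_pos.2 hab
  have hx : 0 ≤ (t - a) / (b - a) * 2 ^ k :=
    mul_nonneg (div_nonneg (sub_nonneg.2 ht.1) h0.le) (by positivity)
  have hx1 : (t - a) / (b - a) * 2 ^ k ≤ 1 * 2 ^ k := by
    gcongr
    exact (div_le_one h0).2 (by linarith [ht.2])
  refine ⟨⌊(t - a) / (b - a) * 2 ^ k⌋₊, ?_, ?_⟩
  · refine Nat.floor_le_of_le ?_
    push_cast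
    linarith
  have h1 := Nat.floor_le hx
  have h2 := Nat.lt_floor_add_one ((t - a) / (b - a) * 2 ^ k)
  set i := ⌊(t - a) / (b - a) * 2 ^ k⌋₊
  have e : t - dyadicPoint a b k i = (b - a) / 2 ^ k * ((t - a) / (b - a) * 2 ^ k - i) := by
    simp only [dyadicPoint]
    field_simp
    ring
  rw [e, abs_mul, abs_of_nonneg (show 0 ≤ (b - a) / 2 ^ k by positivity)]
  refine mul_le_of_le_one_right (by positivity) (abs_le.2 ⟨by linarith, by linarith⟩)

/-- Deterministic chaining bound along the dyadic points. -/
lemma abs_le_of_dyadic_increments {a b : ℝ} (hab : a < b) {g : ℝ → ℝ}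
    (hg : ContinuousOn g (Icc a b)) {K : ℕ} {M q : ℝ}
    (hK : ∀ i ≤ 2 ^ K, |g (dyadicPoint a b K i)| ≤ M) {ε : ℕ → ℝ} (hε0 : ∀ j, 0 ≤ ε j)
    (hε : ∀ j, ∑ k ∈ Finset.range j, ε k ≤ q)
    (hinc : ∀ j, ∀ i < 2 ^ (K + j),
      |g (dyadicPoint a b (K + j + 1) (2 * i + 1)) - g (dyadicPoint a b (K + j) i)| ≤ ε j)
    {t : ℝ} (ht : t ∈ Icc a b) : |g t| ≤ M + q := by
  have hlevel : ∀ j, ∀ i ≤ 2 ^ (K + j),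
      |g (dyadicPoint a b (K + j) i)| ≤ M + ∑ k ∈ Finset.range j, ε k := by
    intro j
    induction j with
    | zero => simpa using hK
    | succ j ih =>
      intro i hi
      rw [Finset.sum_range_succ]
      rw [← add_assoc, pow_succ] at hi
      rcases Nat.even_or_odd' i with ⟨k, rfl | rfl⟩
      · rw [← add_assoc, dyadicPoint_succ]
        have := ih k (by omega)
        linarith [hε0 j]
      · have h1 := ih k (by omega)
        have h2 := hinc j k (by omega)
        have h3 := abs_sub_abs_le_abs_sub (g (dyadicPoint a b (K + j + 1) (2 * k + 1)))
          (g (dyadicPoint a b (K + j) k))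
        rw [← add_assoc]
        linarith
  choose i hi hit using exists_dyadicPoint_abs_sub_le hab ht
  have hlim : Tendsto (fun k => dyadicPoint a b k (i k)) atTop (nhds t) := by
    have h1 : Tendsto (fun k : ℕ => (b - a) / (2 : ℝ) ^ k) atTop (nhds 0) :=
      tendsto_const_nhds.div_atTop (tendsto_pow_atTop_atTop_of_one_lt (by norm_num))
    rw [tendsto_iff_dist_tendsto_zero]
    exact squeeze_zero (fun _ => dist_nonneg)
      (fun k => by rw [dist_comm, Real.dist_eq]; exact hit k) h1
  have hlim' : Tendsto (fun j => dyadicPoint a b (K + j) (i (K + j))) atTop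
      (nhdsWithin t (Icc a b)) :=
    tendsto_nhdsWithin_iff.2 ⟨hlim.comp (tendsto_atTop_mono (fun j => Nat.le_add_left j K)
      tendsto_id), Eventually.of_forall fun j => dyadicPoint_mem_Icc hab.le (hi _)⟩
  refine le_of_tendsto (((hg t ht).tendsto.comp hlim').abs) (Eventually.of_forall fun j => ?_)
  exact (hlevel j _ (hi _)).trans (by linarith [hε j])

lemma iSup_Icc_abs_le_iff {a b z : ℝ} (hab : a ≤ b) {g : ℝ → ℝ} (hg : ContinuousOn g (Icc a b)) :
    (⨆ t : Icc a b, |g t|) ≤ z ↔ ∀ t ∈ Icc a b, |g t| ≤ z := by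
  have : Nonempty (Icc a b) := ⟨⟨a, left_mem_Icc.2 hab⟩⟩
  have hb : BddAbove (range fun t : Icc a b => |g t|) := by
    have := (isCompact_Icc.image_of_continuousOn hg.abs).bddAbove
    rwa [image_eq_range] at this
  rw [ciSup_le_iff hb]
  exact ⟨fun h t ht => h ⟨t, ht⟩, fun h t => h t t.2⟩

lemma sum_geometric_le (q : ℝ) (hq : 0 ≤ q) (j : ℕ) :
    ∑ k ∈ Finset.range j, q / 5 * (4 / 5) ^ k ≤ q := by
  rw [← Finset.mul_sum, geom_sum_eq (by norm_num)]
  have : 0 ≤ q * (4 / 5) ^ j := by positivity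
  linear_combination this

section chaining

variable {T : ℝ} {P : Measure C(ℝ, ℝ)} [IsProbabilityMeasure P] {Ω : Type*} [MeasurableSpace Ω]
  {Q : Measure Ω} {G : Ω → ℝ → ℝ} {a b : ℝ}

/-- Chaining: with high probability, all dyadic increments of `G` beyond level `K` are small. -/
lemma IsBridgeOn.measure_exists_dyadic_increment_le
    (h : ∀ᵐ f : C(ℝ, ℝ) ∂P, IsLandscapeType T f) (hab : a ≤ b)
    (hG : IsBridgeOn P (Icc a b) Q G) (K : ℕ) {q : ℝ} (hq : 0 < q) :
    Q {ω | ∃ j, ∃ i < 2 ^ (K + j), q / 5 * (4 / 5) ^ j ≤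
        |G ω (dyadicPoint a b (K + j + 1) (2 * i + 1)) - G ω (dyadicPoint a b (K + j) i)|}
      ≤ ENNReal.ofReal (115 * (b - a) ^ 2 / (2 ^ K * q ^ 2)) := by
  set ε : ℕ → ℝ := fun j => q / 5 * (4 / 5) ^ j with hε
  set D : ℕ → ℕ → Set Ω := fun j i => {ω | ε j ≤
    |G ω (dyadicPoint a b (K + j + 1) (2 * i + 1)) - G ω (dyadicPoint a b (K + j) i)|} with hD
  have hsub : {ω | ∃ j, ∃ i < 2 ^ (K + j), ε j ≤
        |G ω (dyadicPoint a b (K + j + 1) (2 * i + 1)) - G ω (dyadicPoint a b (K + j) i)|}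
      ⊆ ⋃ j, ⋃ i ∈ Finset.range (2 ^ (K + j)), D j i := by
    rintro ω ⟨j, i, hi, hω⟩
    simp only [mem_iUnion, Finset.mem_range]
    exact ⟨j, i, hi, hω⟩
  have hstep : ∀ j, Q (⋃ i ∈ Finset.range (2 ^ (K + j)), D j i)
      ≤ ENNReal.ofReal (25 * (b - a) ^ 2 / (2 ^ K * q ^ 2) * (25 / 32) ^ j) := fun j => by
    calc Q (⋃ i ∈ Finset.range (2 ^ (K + j)), D j i)
        ≤ ∑ i ∈ Finset.range (2 ^ (K + j)), Q (D j i) := measure_biUnion_finset_le _ _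
      _ ≤ ∑ i ∈ Finset.range (2 ^ (K + j)),
          ENNReal.ofReal (4 * ((b - a) / 2 ^ (K + j + 1)) ^ 2 / ε j ^ 2) := by
          refine Finset.sum_le_sum fun i hi => ?_
          rw [Finset.mem_range] at hi
          rw [← dyadicPoint_succ_sub a b (K + j) i]
          exact hG.measure_le_abs_sub_le h
            (dyadicPoint_mem_Icc hab (by rw [pow_succ]; omega))
            (dyadicPoint_mem_Icc hab hi.le) (by positivity)
      _ = ENNReal.ofReal (2 ^ (K + j) * (4 * ((b - a) / 2 ^ (K + j + 1)) ^ 2 / ε j ^ 2)) := by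
          rw [Finset.sum_const, Finset.card_range, nsmul_eq_mul,
            ENNReal.ofReal_mul (by positivity)]
          congr 1
          rw [ENNReal.ofReal_pow (by norm_num)]
          simp
      _ = _ := by
          congr 1
          have e1 : ((25 : ℝ) / 32) ^ j = (25 / 16) ^ j / 2 ^ j := by rw [← div_pow]; norm_num
          have e2 : ((25 : ℝ) / 16) ^ j * ((4 / 5) ^ j) ^ 2 = 1 := by
            rw [← pow_mul, mul_comm j 2, pow_mul, ← mul_pow]; norm_num
          have e3 : ((4 / 5 : ℝ) ^ j) ^ 2 ≠ 0 := by positivity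
          rw [e1, eq_div_of_mul_eq e3 e2]
          simp only [hε, pow_add, pow_one]
          field_simp
          ring
  have hsum : HasSum (fun j : ℕ => 25 * (b - a) ^ 2 / (2 ^ K * q ^ 2) * (25 / 32 : ℝ) ^ j)
      (25 * (b - a) ^ 2 / (2 ^ K * q ^ 2) * (1 - 25 / 32)⁻¹) :=
    (hasSum_geometric_of_lt_one (by norm_num) (by norm_num)).mul_left _
  calc Q _ ≤ Q (⋃ j, ⋃ i ∈ Finset.range (2 ^ (K + j)), D j i) := measure_mono hsub
    _ ≤ ∑' j, Q (⋃ i ∈ Finset.range (2 ^ (K + j)), D j i) := measure_iUnion_le _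
    _ ≤ ∑' j, ENNReal.ofReal (25 * (b - a) ^ 2 / (2 ^ K * q ^ 2) * (25 / 32) ^ j) :=
        ENNReal.tsum_le_tsum hstep
    _ = ENNReal.ofReal (25 * (b - a) ^ 2 / (2 ^ K * q ^ 2) * (1 - 25 / 32)⁻¹) := by
        rw [← ENNReal.ofReal_tsum_of_nonneg (fun j => by positivity) hsum.summable, hsum.tsum_eq]
    _ ≤ _ := by
        refine ENNReal.ofReal_le_ofReal ?_
        have : 0 ≤ (b - a) ^ 2 / (2 ^ K * q ^ 2) := by positivity
        rw [mul_div_assoc, mul_div_assoc]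
        norm_num
        nlinarith

end chaining

/-! ### Assembly -/

lemma eventually_exists_rate_parameters : ∀ᶠ n : ℕ in atTop, 3 ≤ n ∧ ∃ q ℓ : ℝ,
    0 < q ∧ q ≤ 1 ∧ 1 ≤ ℓ ∧ q ^ 8 * n = ℓ ^ 6 ∧ q ^ 3 * ℓ ^ 7 ≤ 1 ∧ Real.exp (-ℓ ^ 2) ≤ q ∧
      Real.log n = ℓ ^ 2 ∧ q * ℓ = Real.log n ^ ((7 : ℝ) / 8) / (n : ℝ) ^ ((1 : ℝ) / 8) := by
  have hlo := (isLittleO_log_rpow_rpow_atTop (37 / 8) (show (0 : ℝ) < 3 / 8 by norm_num)).bound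
    one_pos
  filter_upwards [tendsto_natCast_atTop_atTop.eventually hlo, eventually_ge_atTop 3] with n hn hn3
  refine ⟨hn3, ?_⟩
  have hn3' : (3 : ℝ) ≤ n := by exact_mod_cast hn3
  have hlog : 1 ≤ Real.log n := by
    rw [Real.le_log_iff_exp_le (by positivity)]
    linarith [Real.exp_one_lt_d9]
  have hn0 : (0 : ℝ) ≤ n := by positivity
  have hlog0 : 0 ≤ Real.log n := by linarith
  set u := Real.log n ^ ((1 : ℝ) / 8) with hu
  set m := (n : ℝ) ^ ((1 : ℝ) / 8) with hm
  have hpowu : ∀ k : ℕ, Real.log n ^ ((k : ℝ) / 8) = u ^ k := fun k => by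
    rw [hu, ← Real.rpow_natCast, ← Real.rpow_mul hlog0]; congr 1; ring
  have hpowm : ∀ k : ℕ, (n : ℝ) ^ ((k : ℝ) / 8) = m ^ k := fun k => by
    rw [hm, ← Real.rpow_natCast, ← Real.rpow_mul hn0]; congr 1; ring
  have hu1 : 1 ≤ u := Real.one_le_rpow hlog (by norm_num)
  have hm0 : 0 < m := Real.rpow_pos_of_pos (by linarith) _
  have hu8 : Real.log n = u ^ 8 := by have := hpowu 8; norm_num at this; exact this
  have hm8 : (n : ℝ) = m ^ 8 := by have := hpowm 8; norm_num at this; exact this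
  have hu7 : Real.log n ^ ((7 : ℝ) / 8) = u ^ 7 := by exact_mod_cast hpowu 7
  have hle : u ^ 37 ≤ m ^ 3 := by
    have h1 := hpowu 37
    have h2 := hpowm 3
    push_cast at h1 h2
    rw [h1, h2, Real.norm_of_nonneg (by positivity), Real.norm_of_nonneg (by positivity),
      one_mul] at hn
    exact hn
  have hu0 : 0 < u := by linarith
  have h37 : (u ^ 3 / m) ^ 3 * (u ^ 4) ^ 7 ≤ 1 := by
    have : (u ^ 3 / m) ^ 3 * (u ^ 4) ^ 7 = u ^ 37 / m ^ 3 := by field_simp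
    rw [this]
    exact (div_le_one (by positivity)).2 hle
  have hℓ : 1 ≤ u ^ 4 := one_le_pow₀ hu1
  have hq0 : 0 < u ^ 3 / m := by positivity
  have hq1 : u ^ 3 / m ≤ 1 := by
    by_contra hcon
    push Not at hcon
    have h1 : 1 < (u ^ 3 / m) ^ 3 := one_lt_pow₀ hcon (by norm_num)
    have h2 : 1 ≤ (u ^ 4) ^ 7 := one_le_pow₀ hℓ
    nlinarith
  refine ⟨u ^ 3 / m, u ^ 4, hq0, hq1, hℓ, ?_, h37, ?_, ?_, ?_⟩
  · rw [hm8]; field_simp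
  · have e : Real.exp (-(u ^ 4) ^ 2) = 1 / m ^ 8 := by
      rw [← pow_mul, ← hu8, Real.exp_neg, Real.exp_log (by linarith), ← hm8, one_div]
    rw [e]
    calc 1 / m ^ 8 ≤ u ^ 24 / m ^ 8 := by
          gcongr
          exact one_le_pow₀ hu1
      _ = (u ^ 3 / m) ^ 8 := by field_simp
      _ ≤ (u ^ 3 / m) ^ 1 := pow_le_pow_of_le_one hq0.le hq1 (by norm_num)
      _ = u ^ 3 / m := pow_one _
  · rw [hu8, ← pow_mul]
  · rw [hu7]; field_simp

lemma log_card_grid_le {n K : ℕ} (hn : 3 ≤ n) (hK : 2 ^ K ≤ 2 * n) :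
    Real.log (Fintype.card (Fin (2 ^ K + 1) × Bool)) ≤ 3 * Real.log n := by
  have h1 : Fintype.card (Fin (2 ^ K + 1) × Bool) ≤ n ^ 3 := by
    simp only [Fintype.card_prod, Fintype.card_fin, Fintype.card_bool]
    have : 9 * n ≤ n ^ 3 := by nlinarith [Nat.mul_le_mul hn hn]
    omega
  calc Real.log (Fintype.card (Fin (2 ^ K + 1) × Bool)) ≤ Real.log ((n : ℝ) ^ 3) := by
        refine Real.log_le_log ?_ (by exact_mod_cast h1)
        exact_mod_cast Fintype.card_pos
    _ = 3 * Real.log n := by rw [Real.log_pow]; norm_num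

lemma continuous_empirical {T : ℝ} {P : Measure C(ℝ, ℝ)} [IsProbabilityMeasure P]
    (h : ∀ᵐ f : C(ℝ, ℝ) ∂P, IsLandscapeType T f) {n : ℕ} (l : Fin n → C(ℝ, ℝ)) :
    Continuous fun t => √n * (empMean n l t - lmean P t) := by
  have h1 : LipschitzWith 1 (lmean P) := LipschitzWith.of_dist_le_mul fun s t => by
    simpa [Real.dist_eq] using abs_lmean_sub_le h s t
  have h2 : Continuous (empMean n l) :=
    (continuous_finsetSum _ fun i _ => (l i).continuous).div_const _
  exact continuous_const.mul (h2.sub h1.continuous)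

lemma abs_empirical_sub_le {T : ℝ} {P : Measure C(ℝ, ℝ)} [IsProbabilityMeasure P]
    (h : ∀ᵐ f : C(ℝ, ℝ) ∂P, IsLandscapeType T f) {n : ℕ} (hn : n ≠ 0) {l : Fin n → C(ℝ, ℝ)}
    (hl : ∀ i, IsLandscapeType T (l i)) (s t : ℝ) :
    |√n * (empMean n l s - lmean P s) - √n * (empMean n l t - lmean P t)| ≤ 2 * √n * |s - t| := by
  have h1 : |empMean n l s - empMean n l t| ≤ |s - t| := by
    rw [empMean, empMean, ← sub_div, ← Finset.sum_sub_distrib, abs_div, Nat.abs_cast,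
      div_le_iff₀ (by positivity)]
    calc |∑ i, (l i s - l i t)| ≤ ∑ i, |l i s - l i t| := Finset.abs_sum_le_sum_abs _ _
      _ ≤ ∑ _i : Fin n, |s - t| := Finset.sum_le_sum fun i _ => (hl i).abs_sub_le s t
      _ = |s - t| * n := by simp [mul_comm]
  have h2 := abs_lmean_sub_le h s t
  have h3 : |empMean n l s - lmean P s - (empMean n l t - lmean P t)| ≤ 2 * |s - t| := by
    rw [abs_le] at *
    constructor <;> linarith
  rw [← mul_sub, abs_mul, abs_of_nonneg (Real.sqrt_nonneg _)]
  calc _ ≤ √n * (2 * |s - t|) := by gcongr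
    _ = _ := by ring

/-- If the empirical process is at most `z` on the dyadic grid, then it is at most
`z + 2 * √n * (b - a) / 2 ^ K` on the interval. -/
lemma abs_empirical_le_of_dyadicPoint {T : ℝ} {P : Measure C(ℝ, ℝ)} [IsProbabilityMeasure P]
    (h : ∀ᵐ f : C(ℝ, ℝ) ∂P, IsLandscapeType T f) {n : ℕ} (hn : n ≠ 0) {l : Fin n → C(ℝ, ℝ)}
    (hl : ∀ i, IsLandscapeType T (l i)) {a b z : ℝ} (hab : a < b) {K : ℕ}
    (hz : ∀ i ≤ 2 ^ K, |√n * (empMean n l (dyadicPoint a b K i)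
      - lmean P (dyadicPoint a b K i))| ≤ z) {t : ℝ} (ht : t ∈ Icc a b) :
    |√n * (empMean n l t - lmean P t)| ≤ z + 2 * √n * ((b - a) / 2 ^ K) := by
  obtain ⟨i, hi, hti⟩ := exists_dyadicPoint_abs_sub_le hab ht K
  have h1 := abs_empirical_sub_le h hn hl t (dyadicPoint a b K i)
  have h2 : 2 * √n * |t - dyadicPoint a b K i| ≤ 2 * √n * ((b - a) / 2 ^ K) := by gcongr
  have h3 := abs_sub_abs_le_abs_sub (√n * (empMean n l t - lmean P t))
    (√n * (empMean n l (dyadicPoint a b K i) - lmean P (dyadicPoint a b K i)))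
  linarith [hz i hi]

/-- Comparison of the two distribution functions for a fixed sample size. -/
theorem exists_abs_measureReal_iSup_sub_le {T : ℝ} (hT : 0 < T)
    {P : Measure C(ℝ, ℝ)} [IsProbabilityMeasure P]
    (h : ∀ᵐ f : C(ℝ, ℝ) ∂P, IsLandscapeType T f)
    {a b c : ℝ} (hab : a < b) (hc : 0 < c) (hbaT : b - a ≤ T) (hσ : ∀ t ∈ Icc a b, c ≤ lsd P t)
    {Ω : Type} [MeasurableSpace Ω] {Q : Measure Ω} [IsProbabilityMeasure Q]
    {G : Ω → ℝ → ℝ} (hGcont : ∀ ω, ContinuousOn (G ω) (Icc a b))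
    (hG : IsBridgeOn P (Icc a b) Q G) :
    ∃ C > (0 : ℝ), ∀ {n : ℕ} {q ℓ : ℝ}, 3 ≤ n → 0 < q → q ≤ 1 → 1 ≤ ℓ → q ^ 8 * n = ℓ ^ 6 →
      q ^ 3 * ℓ ^ 7 ≤ 1 → Real.exp (-ℓ ^ 2) ≤ q → Real.log n = ℓ ^ 2 → ∀ z : ℝ,
      |(Measure.pi fun _ : Fin n => P).real
          {l | (⨆ t : Icc a b, |√n * (empMean n l t - lmean P t)|) ≤ z}
        - Q.real {ω | (⨆ t : Icc a b, |G ω t|) ≤ z}| ≤ C * (q * ℓ) := by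
  obtain ⟨C, hC, happrox⟩ := exists_measureReal_forall_le_approx (B := T / 2) (c := c)
    (D := 1 + 2 * T) (by positivity) hc (by positivity)
  refine ⟨C + 115 * T ^ 2 + 1, by positivity, ?_⟩
  intro n q ℓ hn3 hq hq1 hℓ hqn hqℓ hexp hlog z
  have hn0 : n ≠ 0 := by omega
  have hℓ0 : 0 < ℓ := by linarith
  have hnpos : (0 : ℝ) < n := by positivity
  have hba : 0 < b - a := sub_pos.2 hab
  set K := Nat.log 2 n + 1 with hKdef
  have hK1 : n ≤ 2 ^ K := (Nat.lt_pow_succ_log_self (by norm_num) n).le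
  have hK2 : 2 ^ K ≤ 2 * n := by
    have := Nat.pow_log_le_self 2 hn0
    rw [hKdef, pow_succ]; omega
  have hK1' : (n : ℝ) ≤ 2 ^ K := by exact_mod_cast hK1
  set s : Fin (2 ^ K + 1) → ℝ := fun i => dyadicPoint a b K i with hs
  have hsI : ∀ i, s i ∈ Icc a b := fun i => dyadicPoint_mem_Icc hab.le (Nat.lt_succ_iff.1 i.2)
  have hgrid : ∀ {g : ℝ → ℝ} {z' : ℝ},
      (∀ i, |g (s i)| ≤ z') ↔ ∀ i ≤ 2 ^ K, |g (dyadicPoint a b K i)| ≤ z' := fun {g z'} =>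
    ⟨fun H i hi => H ⟨i, Nat.lt_succ_iff.2 hi⟩, fun H i => H i (Nat.lt_succ_iff.1 i.2)⟩
  set γ := Q.map fun ω => signedValues s (G ω) with hγ
  have : IsGaussian γ := hG.isGaussian_map_signedValues hsI
  have hAE := hG.aemeasurable_signedValues hsI
  have hcov : ∀ t ∈ Icc a b, c ^ 2 ≤ lcov P t t := fun t ht => by
    have h1 := (Real.le_sqrt' hc).1 (hσ t ht)
    simpa [lvar, lcov, sq] using h1
  have hvar : ∀ j, c ^ 2 ≤ ∫ y, y j * y j ∂γ := fun j => by
    rw [hγ, hG.integral_mul_map_signedValues h hsI]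
    have h1 := hcov _ (hsI j.1)
    rcases j with ⟨i, _ | _⟩ <;> simpa using h1
  have hnn : ∀ᵐ y ∂γ, ∃ j, 0 ≤ y j := by
    have hms : MeasurableSet {y : Fin (2 ^ K + 1) × Bool → ℝ | ∃ j, 0 ≤ y j} := by
      rw [ofPred_exists]
      exact MeasurableSet.iUnion fun j => measurableSet_le measurable_const (measurable_pi_apply j)
    rw [hγ, ae_map_iff hAE hms]
    refine ae_of_all _ fun ω => ?_
    rcases le_total 0 (G ω (s 0)) with h0 | h0
    · exact ⟨(0, true), by simpa [signedValues] using h0⟩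
    · exact ⟨(0, false), by simpa [signedValues] using h0⟩
  have hmain := fun z' => happrox (measurable_signedValues_sub_lmean (P := P) s)
    (ae_abs_signedValues_sub_lmean_le h s) (integral_signedValues_sub_lmean h s)
    (hG.integral_id_map_signedValues hsI)
    (fun j k => (hG.integral_mul_map_signedValues h hsI j k).trans
      (integral_signedValues_sub_lmean_mul h s j k).symm) hvar hnn hn0 hq hq1 hℓ hqn hqℓ hexp
    (hlog ▸ log_card_grid_le hn3 hK2) z'
  simp only [smul_sum_signedValues_sub_lmean hn0, forall_signedValues_le_iff] at hmain
  rw [← hγ] at hmain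
  have hγQ : ∀ z', γ.real {y | ∀ j, y j ≤ z'}
      = Q.real {ω | ∀ i ≤ 2 ^ K, |G ω (dyadicPoint a b K i)| ≤ z'} := fun z' => by
    have hms : MeasurableSet {y : Fin (2 ^ K + 1) × Bool → ℝ | ∀ j, y j ≤ z'} :=
      measurableSet_forall_le measurable_id z'
    rw [hγ, measureReal_def, Measure.map_apply_of_aemeasurable hAE hms, measureReal_def]
    simp only [preimage_ofPred_eq, forall_signedValues_le_iff, hgrid]
  have hShift : 2 * √n * ((b - a) / 2 ^ K) ≤ (1 + 2 * T) * q := by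
    have hsq : √(n : ℝ) = ℓ ^ 3 / q ^ 4 := by
      rw [show (n : ℝ) = (ℓ ^ 3 / q ^ 4) ^ 2 by field_simp; linarith,
        Real.sqrt_sq (by positivity)]
    have h1 : √(n : ℝ) * (1 / n) ≤ q := by
      have e : √(n : ℝ) * (1 / n) = q ^ 4 / ℓ ^ 3 := by
        rw [hsq, show (n : ℝ) = (ℓ ^ 3 / q ^ 4) ^ 2 by field_simp; linarith]
        field_simp
      rw [e, div_le_iff₀ (by positivity)]
      calc q ^ 4 ≤ q ^ 1 := pow_le_pow_of_le_one hq.le hq1 (by norm_num)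
        _ = q * 1 := by ring
        _ ≤ q * ℓ ^ 3 := by gcongr; exact one_le_pow₀ hℓ
    calc 2 * √n * ((b - a) / 2 ^ K) ≤ 2 * √n * (T / n) := by gcongr
      _ = 2 * T * (√n * (1 / n)) := by ring
      _ ≤ 2 * T * q := by gcongr
      _ ≤ _ := by linarith
  have hbad := hG.measure_exists_dyadic_increment_le h hab.le K hq
  set bad := {ω | ∃ j, ∃ i < 2 ^ (K + j), q / 5 * (4 / 5) ^ j ≤
    |G ω (dyadicPoint a b (K + j + 1) (2 * i + 1)) - G ω (dyadicPoint a b (K + j) i)|} with hbd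
  have hbad' : Q.real bad ≤ 115 * T ^ 2 * (q * ℓ) := by
    rw [measureReal_def]
    refine (ENNReal.toReal_le_of_le_ofReal (by positivity) hbad).trans ?_
    have h1 : 115 * (b - a) ^ 2 / (2 ^ K * q ^ 2) ≤ 115 * T ^ 2 / (n * q ^ 2) := by gcongr
    refine h1.trans ?_
    rw [div_le_iff₀ (by positivity)]
    have h2 : 1 ≤ (q * ℓ) * (n * q ^ 2) := by
      have e : q ^ 5 * ((q * ℓ) * (n * q ^ 2)) = ℓ ^ 7 := by
        calc _ = (q ^ 8 * n) * ℓ := by ring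
          _ = _ := by rw [hqn]; ring
      have h3 : q ^ 5 ≤ 1 := pow_le_one₀ hq.le hq1
      have h4 : 1 ≤ ℓ ^ 7 := one_le_pow₀ hℓ
      have h5 : 0 ≤ (q * ℓ) * (n * q ^ 2) := by positivity
      nlinarith
    calc 115 * T ^ 2 = 115 * T ^ 2 * 1 := by ring
      _ ≤ 115 * T ^ 2 * ((q * ℓ) * (n * q ^ 2)) := by gcongr
      _ = _ := by ring
  have hqℓ0 : 0 ≤ q * ℓ := by positivity
  have hAl : ∀ᵐ l ∂(Measure.pi fun _ : Fin n => P), ∀ i, IsLandscapeType T (l i) :=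
    eventually_all.2 fun i =>
      (Measure.tendsto_eval_ae_ae (μ := fun _ : Fin n => P) (i := i)).eventually h
  have hupper : (Measure.pi fun _ : Fin n => P).real
        {l | (⨆ t : Icc a b, |√n * (empMean n l t - lmean P t)|) ≤ z}
      ≤ Q.real {ω | (⨆ t : Icc a b, |G ω t|) ≤ z} + (C + 115 * T ^ 2) * (q * ℓ) := by
    have h1 := (hmain z).1
    have h2 : (Measure.pi fun _ : Fin n => P).real
          {l | (⨆ t : Icc a b, |√n * (empMean n l t - lmean P t)|) ≤ z}
        ≤ (Measure.pi fun _ : Fin n => P).real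
          {l | ∀ i, |√n * (empMean n l (s i) - lmean P (s i))| ≤ z} :=
      measureReal_mono fun l hl i =>
        (iSup_Icc_abs_le_iff hab.le (continuous_empirical h l).continuousOn).1 hl _ (hsI i)
    have h3 : γ.real {y | ∀ j, y j ≤ z - (1 + 2 * T) * q}
        ≤ Q.real {ω | (⨆ t : Icc a b, |G ω t|) ≤ z} + Q.real bad := by
      rw [hγQ]
      refine (measureReal_mono fun ω hω => ?_).trans (measureReal_union_le _ _)
      by_cases hb : ω ∈ bad
      · exact Or.inr hb
      · refine Or.inl ((iSup_Icc_abs_le_iff hab.le (hGcont ω)).2 fun t ht => ?_)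
        have h4 := abs_le_of_dyadic_increments hab (hGcont ω) hω
          (ε := fun j => q / 5 * (4 / 5) ^ j) (fun j => by positivity)
          (sum_geometric_le q hq.le) (fun j i hi => by
            by_contra hcon
            exact hb ⟨j, i, hi, (not_le.1 hcon).le⟩) ht
        have : 0 ≤ T * q := by positivity
        linarith
    linarith
  have hlower : Q.real {ω | (⨆ t : Icc a b, |G ω t|) ≤ z}
      ≤ (Measure.pi fun _ : Fin n => P).real
        {l | (⨆ t : Icc a b, |√n * (empMean n l t - lmean P t)|) ≤ z} + C * (q * ℓ) := by
    have h1 := (hmain (z - (1 + 2 * T) * q)).2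
    rw [sub_add_cancel, hγQ] at h1
    have h2 : Q.real {ω | (⨆ t : Icc a b, |G ω t|) ≤ z}
        ≤ Q.real {ω | ∀ i ≤ 2 ^ K, |G ω (dyadicPoint a b K i)| ≤ z} :=
      measureReal_mono fun ω hω i hi =>
        (iSup_Icc_abs_le_iff hab.le (hGcont ω)).1 hω _ (dyadicPoint_mem_Icc hab.le hi)
    have h3 : (Measure.pi fun _ : Fin n => P).real
          {l | ∀ i, |√n * (empMean n l (s i) - lmean P (s i))| ≤ z - (1 + 2 * T) * q}
        ≤ (Measure.pi fun _ : Fin n => P).real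
          {l | (⨆ t : Icc a b, |√n * (empMean n l t - lmean P t)|) ≤ z} := by
      refine ENNReal.toReal_mono (measure_ne_top _ _) (measure_mono_ae ?_)
      filter_upwards [hAl] with l hl hz
      refine (iSup_Icc_abs_le_iff hab.le (continuous_empirical h l).continuousOn).2 fun t ht => ?_
      have h4 := abs_empirical_le_of_dyadicPoint h hn0 hl hab
        ((hgrid (g := fun t => √n * (empMean n l t - lmean P t))).1 hz) ht
      linarith
    linarith
  rw [abs_le]
  constructor
  · nlinarith [sq_nonneg T]
  · nlinarith [sq_nonneg T]

/-- **Uniform CLT for landscapes.**  Let `P` be concentrated on landscape-type functions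
with `σ(t) ≥ c > 0` on `[t₁, t₂] ⊆ [0, T]`, and let `G` be a Brownian bridge with
covariance `κ(t,s) = ∫ λ(t)λ(s) dP − μ(t)μ(s)` on `[t₁,t₂]` (continuous sample paths,
and every finite linear combination `Σ a_i G(s_i)` centered Gaussian with variance
`Σ_{i,j} a_i a_j κ(s_i,s_j)`).  Then there are `C > 0` and `N₀` such that for all
`n ≥ N₀`,
`sup_z |Pⁿ(sup_{t∈[t₁,t₂]} |𝔾_n(t)| ≤ z) − P(sup_{t∈[t₁,t₂]} |G(t)| ≤ z)|
  ≤ C (log n)^{7/8} n^{−1/8}`,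
where `𝔾_n(t) = √n (λ̄_n(t) − μ(t))`. -/
theorem uniform_CLT_landscapes (T : ℝ) (hT : 0 < T)
    (P : Measure C(ℝ, ℝ)) [IsProbabilityMeasure P]
    (hP : P {f | IsLandscapeType T f} = 1)
    (t₁ t₂ c : ℝ) (ht₁ : 0 ≤ t₁) (h₁₂ : t₁ < t₂) (ht₂ : t₂ ≤ T) (hc : 0 < c)
    (hσ : ∀ t ∈ Icc t₁ t₂, c ≤ lsd P t)
    (Ω : Type) [MeasurableSpace Ω] (Q : Measure Ω) [IsProbabilityMeasure Q]
    (G : Ω → ℝ → ℝ)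
    (hGcont : ∀ ω, ContinuousOn (G ω) (Icc t₁ t₂))
    (hGgauss : ∀ (m : ℕ) (s : Fin m → ℝ), (∀ i, s i ∈ Icc t₁ t₂) → ∀ a : Fin m → ℝ,
      Measure.map (fun ω => ∑ i, a i * G ω (s i)) Q =
        gaussianReal 0 (∑ i, ∑ j, a i * a j * lcov P (s i) (s j)).toNNReal) :
    ∃ C > (0 : ℝ), ∃ N₀ : ℕ, ∀ n ≥ N₀, ∀ z : ℝ,
      |((Measure.pi fun _ : Fin n => P)
            {l | (⨆ t : Icc t₁ t₂, |Real.sqrt n * (empMean n l ↑t - lmean P ↑t)|) ≤ z}).toReal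
          - (Q {ω | (⨆ t : Icc t₁ t₂, |G ω ↑t|) ≤ z}).toReal|
        ≤ C * Real.log n ^ ((7 : ℝ) / 8) / (n : ℝ) ^ ((1 : ℝ) / 8) := by
  obtain ⟨C, hC, hbound⟩ := exists_abs_measureReal_iSup_sub_le hT (ae_isLandscapeType hP) h₁₂ hc
    (by linarith) hσ hGcont hGgauss
  obtain ⟨N₀, hN₀⟩ := eventually_atTop.1 eventually_exists_rate_parameters
  refine ⟨C, hC, N₀, fun n hn z => ?_⟩
  obtain ⟨hn3, q, ℓ, hq, hq1, hℓ, hqn, hqℓ, hexp, hlog, hrate⟩ := hN₀ n hn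
  rw [mul_div_assoc, ← hrate]
  exact hbound hn3 hq hq1 hℓ hqn hqℓ hexp hlog z
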